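/- arXiv:1708.06815 — 5 statements merged into one kernel-verified Lean document; each statement's English description precedes it below -/
import Mathlib

section
/- Let G be a loopless weighted graph, i.e., assume q_e ≠ 0 for every edge e. Then the dimension of the Q-deformation as a K-vector space equals the number of distinct score vectors of orientations of G: dim_K Ψ_{G,Q} = #{D ∈ K^n : there exists an orientation o of G with D = D_o}. -/
open MvPolynomial

set_option synthInstance.maxHeartbeats 1000000
set_option maxHeartbeats 1000000

noncomputable section

/-- The ideal of relations `u_e ^ 2 = q_e * u_e`. -/
def relIdeal (K : Type*) [Field K] (E : Type*) (q : E → K) :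
    Ideal (MvPolynomial E K) :=
  Ideal.span (Set.range fun e : E => (X e) ^ 2 - C (q e) * X e)

/-- The algebra `Φ_{G,Q}`. -/
abbrev PhiAlg (K : Type*) [Field K] (E : Type*) (q : E → K) : Type _ :=
  MvPolynomial E K ⧸ relIdeal K E q

/-- The generator `X_i` of the `Q`-deformation. -/
def XX (K : Type*) [Field K] {n : ℕ} {E : Type*} [Fintype E]
    (a b : E → Fin n) (q : E → K) (i : Fin n) : PhiAlg K E q :=
  Ideal.Quotient.mk _
    ((∑ e ∈ Finset.univ.filter fun e => a e = i, X e) -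
      ∑ e ∈ Finset.univ.filter fun e => b e = i, X e)

/-- The `Q`-deformation `Ψ_{G,Q}` of the Postnikov–Shapiro algebra. -/
def PsiAlg (K : Type*) [Field K] {n : ℕ} {E : Type*} [Fintype E]
    (a b : E → Fin n) (q : E → K) : Subalgebra K (PhiAlg K E q) :=
  Algebra.adjoin K (Set.range (XX K a b q))

/-- The head of edge `e` under orientation `o`. -/
def head {n : ℕ} {E : Type*} (a b : E → Fin n) (o : E → Bool) (e : E) : Fin n :=
  if o e then a e else b e

/-- The tail of edge `e` under orientation `o`. -/
def tail {n : ℕ} {E : Type*} (a b : E → Fin n) (o : E → Bool) (e : E) : Fin n :=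
  if o e then b e else a e

/-- The score vector of an orientation. -/
def score (K : Type*) [Field K] {n : ℕ} {E : Type*} [Fintype E]
    (a b : E → Fin n) (q : E → K) (o : E → Bool) (i : Fin n) : K :=
  ∑ e ∈ Finset.univ.filter fun e => head a b o e = i, q e

/-- Evaluation of polynomials at the orientations. -/
def evO {K : Type*} [Field K] {E : Type*} (q : E → K) :
    MvPolynomial E K →ₐ[K] ((E → Bool) → K) :=
  aeval (fun e o => if o e then q e else 0)

lemma evO_X {K : Type*} [Field K] {E : Type*} (q : E → K) (e : E) (o : E → Bool) :
    evO q (X e) o = if o e then q e else 0 := by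
  simp [evO]

lemma relIdeal_le {K : Type*} [Field K] {E : Type*} (q : E → K) :
    ∀ p ∈ relIdeal K E q, evO q p = 0 := by
  intro p hp
  have : relIdeal K E q ≤ RingHom.ker (evO q) := by
    rw [relIdeal, Ideal.span_le]
    rintro _ ⟨e, rfl⟩
    rw [SetLike.mem_coe, RingHom.mem_ker]
    ext o
    simp only [map_sub, map_mul, map_pow, Pi.sub_apply, Pi.mul_apply, Pi.pow_apply, evO_X,
      Pi.zero_apply]
    simp only [evO, aeval_C, Pi.algebraMap_apply, Algebra.algebraMap_self, RingHom.id_apply]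
    split_ifs <;> ring
  exact this hp

/-- The induced map on the quotient. -/
def evPhi {K : Type*} [Field K] {E : Type*} (q : E → K) :
    PhiAlg K E q →ₐ[K] ((E → Bool) → K) :=
  Ideal.Quotient.liftₐ (relIdeal K E q) (evO q) (relIdeal_le q)

lemma evPhi_mk {K : Type*} [Field K] {E : Type*} (q : E → K) (p : MvPolynomial E K) :
    evPhi q (Ideal.Quotient.mk _ p) = evO q p := rfl

lemma evPhi_injective {K : Type*} [Field K] {E : Type*} [Fintype E] [DecidableEq E]
    (q : E → K) (hq : ∀ e, q e ≠ 0) : Function.Injective (evPhi q) := by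
  rw [injective_iff_map_eq_zero]
  intro x hx
  obtain ⟨p, rfl⟩ := Ideal.Quotient.mk_surjective x
  rw [evPhi_mk] at hx
  set π : MvPolynomial E K →+* PhiAlg K E q := Ideal.Quotient.mk (relIdeal K E q) with hπ
  have hrel : ∀ e, π (X e) * π (X e) = π (C (q e)) * π (X e) := by
    intro e
    rw [← map_mul, ← map_mul, hπ, Ideal.Quotient.eq]
    refine Ideal.subset_span ⟨e, ?_⟩
    simp only; ring
  have hinv : ∀ e, π (C (q e)) * π (C (q e)⁻¹) = 1 := by
    intro e
    rw [← map_mul, ← C_mul, mul_inv_cancel₀ (hq e), C_1, map_one]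
  let f : E → Bool → PhiAlg K E q := fun e c =>
    if c then π (C (q e)⁻¹) * π (X e) else 1 - π (C (q e)⁻¹) * π (X e)
  let ε : (E → Bool) → PhiAlg K E q := fun o => ∏ e, f e (o e)
  have hsum : ∑ o, ε o = 1 := by
    have := Fintype.prod_sum f
    rw [← this]
    simp [f]
  have hf : ∀ e c, π (X e) * f e c = π (C (if c then q e else 0)) * f e c := by
    intro e c
    cases c
    · simp only [f, Bool.false_eq_true, if_false, C_0, map_zero, zero_mul]
      linear_combination (-π (C (q e)⁻¹)) * hrel e - π (X e) * hinv e
    · simp only [f, if_true]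
      linear_combination (π (C (q e)⁻¹)) * hrel e
  have key : ∀ (p : MvPolynomial E K) o, π p * ε o = π (C (evO q p o)) * ε o := by
    intro p o
    induction p using MvPolynomial.induction_on with
    | C r => simp [evO]
    | add p r hp hr =>
      rw [map_add, map_add, Pi.add_apply, C_add, map_add, add_mul, add_mul, hp, hr]
    | mul_X p e hp =>
      rw [map_mul, map_mul, Pi.mul_apply, C_mul, map_mul, evO_X]
      have h : π (X e) * ε o = π (C (if o e then q e else 0)) * ε o := by
        have he : ε o = f e (o e) * ∏ e' ∈ Finset.univ.erase e, f e' (o e') :=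
          (Finset.mul_prod_erase _ _ (Finset.mem_univ e)).symm
        rw [he, ← mul_assoc, hf, mul_assoc]
      rw [mul_assoc, h]
      linear_combination (π (C (if o e then q e else 0))) * hp
  calc π p = ∑ o, π p * ε o := by rw [← Finset.mul_sum, hsum, mul_one]
    _ = 0 := by
      refine Finset.sum_eq_zero fun o _ => ?_
      rw [key, hx]; simp

lemma separating_top {K : Type*} [Field K] {S : Type*} [Fintype S] [DecidableEq S]
    (A : Subalgebra K (S → K)) (hA : ∀ s t : S, s ≠ t → ∃ f ∈ A, f s ≠ f t) : A = ⊤ := by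
  have h1 : ∀ s t : S, ∃ f ∈ A, f s = 1 ∧ (s ≠ t → f t = 0) := by
    intro s t
    by_cases hst : s = t
    · exact ⟨1, A.one_mem, rfl, fun h => absurd hst h⟩
    · obtain ⟨f, hf, hne⟩ := hA s t hst
      refine ⟨(f s - f t)⁻¹ • (f - algebraMap K _ (f t)),
        A.smul_mem (A.sub_mem hf (A.algebraMap_mem _)) _, ?_, fun _ => ?_⟩
      · simp [inv_mul_cancel₀ (sub_ne_zero.2 hne)]
      · simp
  choose g hgA hg1 hg0 using h1
  have h2 : ∀ s, Pi.single s (1 : K) ∈ A := by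
    intro s
    have : Pi.single s (1 : K) = ∏ t, g s t := by
      ext u
      rw [Finset.prod_apply]
      by_cases hu : u = s
      · subst hu; simp [hg1]
      · rw [Pi.single_eq_of_ne hu]
        exact (Finset.prod_eq_zero (f := fun c => g s c u) (Finset.mem_univ u) (hg0 s u (Ne.symm hu))).symm
    rw [this]
    exact A.prod_mem fun t _ => hgA s t
  rw [eq_top_iff]
  intro f _
  have : f = ∑ s, f s • Pi.single s (1 : K) := by
    ext u
    simp [Finset.sum_apply, Pi.single_apply]
  rw [this]
  exact A.sum_mem fun s _ => A.smul_mem (h2 s) _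

lemma evPhi_XX {K : Type*} [Field K] {n : ℕ} {E : Type*} [Fintype E]
    (a b : E → Fin n) (q : E → K) (hab : ∀ e, a e < b e) (i : Fin n) (o : E → Bool) :
    evPhi q (XX K a b q i) o = score K a b q o i - ∑ e, if b e = i then q e else 0 := by
  rw [XX, evPhi_mk, map_sub, map_sum, map_sum, Pi.sub_apply, Finset.sum_apply, Finset.sum_apply,
    score]
  simp only [evO_X, Finset.sum_filter]
  rw [← Finset.sum_sub_distrib, ← Finset.sum_sub_distrib]
  refine Finset.sum_congr rfl fun e _ => ?_
  have := (hab e).ne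
  unfold head
  by_cases ho : o e <;> by_cases h1 : a e = i <;> by_cases h2 : b e = i <;> simp [ho, h1, h2]

/-- For a loopless weighted graph (all `q_e ≠ 0`), the dimension of the
`Q`-deformation `Ψ_{G,Q}` equals the number of distinct score vectors of orientations. -/
theorem dim_Psi_eq_card_score_vectors
    {K : Type*} [Field K] [CharZero K] {n : ℕ} {E : Type*} [Fintype E] [DecidableEq E]
    (a b : E → Fin n) (q : E → K)
    (hab : ∀ e, a e < b e) (hq : ∀ e, q e ≠ 0) :
    Module.finrank K (PsiAlg K a b q) =
      Set.ncard {D : Fin n → K | ∃ o : E → Bool, D = score K a b q o} := by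
  classical
  let S : Set (Fin n → K) := Set.range (score K a b q)
  have hS : {D : Fin n → K | ∃ o : E → Bool, D = score K a b q o} = S := by
    ext D; simp only [S, Set.mem_ofPred_eq, Set.mem_range, eq_comm]
  haveI : Fintype S := Fintype.ofFinite S
  let g : (S → K) →ₐ[K] ((E → Bool) → K) :=
    AlgHom.pi fun o => Pi.evalAlgHom K (fun _ : S => K) ⟨score K a b q o, o, rfl⟩
  have hg : Function.Injective g := by
    intro x y hxy
    ext ⟨_, o, rfl⟩
    exact congrFun hxy o
  let Z : Fin n → (S → K) := fun i s => s.1 i - ∑ e, if b e = i then q e else 0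
  have hZ : Algebra.adjoin K (Set.range Z) = ⊤ := by
    refine separating_top _ fun s t hst => ?_
    have : ∃ i, s.1 i ≠ t.1 i := by
      by_contra! h
      exact hst (Subtype.ext (funext h))
    obtain ⟨i, hi⟩ := this
    exact ⟨Z i, Algebra.subset_adjoin ⟨i, rfl⟩, fun h => hi (sub_left_injective h)⟩
  have hmap : (PsiAlg K a b q).map (evPhi q) = g.range := by
    rw [PsiAlg, AlgHom.map_adjoin, ← Algebra.map_top, ← hZ, AlgHom.map_adjoin, ← Set.range_comp,
      ← Set.range_comp]
    congr 2
    ext i o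
    exact evPhi_XX a b q hab i o
  have e1 := ((PsiAlg K a b q).equivMapOfInjective (evPhi q)
    (evPhi_injective q hq)).toLinearEquiv.finrank_eq
  have e2 := (AlgEquiv.ofInjective g hg).toLinearEquiv.finrank_eq
  rw [hS, e1, hmap, ← e2, Module.finrank_fintype_fun_eq_card, ← Nat.card_eq_fintype_card]
  rfl

end
end

section
/- For any loopless graph G, the number of spanning forests of G equals the number of distinct in-degree vectors arising from orientations of G, i.e., #{F ⊆ E : F is a forest of G} = #{d ∈ ℕ^n : there exists an orientation o of G with d(i) = #{e : head(o,e) = i} for all i}. -/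
open MvPolynomial

set_option synthInstance.maxHeartbeats 1000000
set_option maxHeartbeats 1000000

noncomputable section

/-- The vector `χ_{a e} - χ_{b e}` in `ℚ^n` associated to an edge. -/
def edgeVec {n : ℕ} {E : Type*} (a b : E → Fin n) (e : E) : Fin n → ℚ :=
  fun i => (if a e = i then 1 else 0) - (if b e = i then 1 else 0)

/-- A subset of the edges is a forest if the associated vectors are linearly independent. -/
def IsForest {n : ℕ} {E : Type*} (a b : E → Fin n) (F : Finset E) : Prop :=
  LinearIndependent ℚ fun e : F => edgeVec a b (e : E)


section Helpers

variable {n : ℕ} {E : Type*} [DecidableEq E]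

lemma sum_ind (R : Finset (Fin n)) (j : Fin n) :
    ∑ i ∈ R, (if j = i then (1:ℚ) else 0) = if j ∈ R then 1 else 0 := by
  simp

lemma sum_edgeVec (a b : E → Fin n) (R : Finset (Fin n)) (e : E) :
    ∑ i ∈ R, edgeVec a b e i = (if a e ∈ R then 1 else 0) - (if b e ∈ R then 1 else 0) := by
  simp only [edgeVec, Finset.sum_sub_distrib, sum_ind]

/-- path extraction -/
lemma exists_path (p q : E → Fin n) (H : Finset E) (v w : Fin n) (k : ℚ) (hk : 0 < k)
    (hH : ∀ i, ∑ e ∈ H, edgeVec p q e i = k * ((if v = i then 1 else 0) - (if w = i then 1 else 0))) :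
    ∃ U ⊆ H, ∀ i, ∑ e ∈ U, edgeVec p q e i = (if v = i then 1 else 0) - (if w = i then 1 else 0) := by
  classical
  let Good : Finset (Fin n) → Prop := fun W => w ∈ W ∧ ∀ r ∈ W, ∃ U ⊆ H,
    (∀ e ∈ U, p e ∈ W) ∧
    ∀ i, ∑ e ∈ U, edgeVec p q e i = (if r = i then 1 else 0) - (if w = i then 1 else 0)
  have h0 : Good {w} := by
    refine ⟨by simp, fun r hr => ⟨∅, by simp, by simp, fun i => ?_⟩⟩
    rw [Finset.mem_singleton] at hr
    simp [hr]
  obtain ⟨W, hW, hmax⟩ := Finset.exists_max_image (Finset.univ.filter Good) Finset.card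
    ⟨{w}, by simpa using h0⟩
  have hG : Good W := by simpa using hW
  have hclosed : ∀ e ∈ H, q e ∈ W → p e ∈ W := by
    intro e he hq
    by_contra hp
    have : Good (insert (p e) W) := by
      refine ⟨Finset.mem_insert_of_mem hG.1, fun r hr => ?_⟩
      rcases Finset.mem_insert.1 hr with rfl | hr
      · obtain ⟨U, hUH, hUW, hU⟩ := hG.2 _ hq
        have heU : e ∉ U := fun h => hp (hUW e h)
        refine ⟨insert e U, Finset.insert_subset he hUH, ?_, fun i => ?_⟩
        · intro f hf
          rcases Finset.mem_insert.1 hf with rfl | hf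
          · simp
          · exact Finset.mem_insert_of_mem (hUW f hf)
        · rw [Finset.sum_insert heU, hU]
          simp only [edgeVec]
          ring
      · obtain ⟨U, hUH, hUW, hU⟩ := hG.2 _ hr
        exact ⟨U, hUH, fun f hf => Finset.mem_insert_of_mem (hUW f hf), hU⟩
    have h2 := hmax _ (by simpa using this)
    rw [Finset.card_insert_of_notMem hp] at h2
    omega
  have hv : v ∈ W := by
    by_contra hv
    have h1 : ∑ i ∈ W, ∑ e ∈ H, edgeVec p q e i = - k := by
      simp only [hH]
      rw [← Finset.mul_sum, Finset.sum_sub_distrib, sum_ind, sum_ind, if_neg hv, if_pos hG.1]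
      ring
    rw [Finset.sum_comm] at h1
    have h2 : 0 ≤ ∑ e ∈ H, ∑ i ∈ W, edgeVec p q e i := by
      refine Finset.sum_nonneg fun e he => ?_
      rw [sum_edgeVec]
      have := hclosed e he
      split_ifs <;> simp_all
    linarith
  obtain ⟨U, hUH, -, hU⟩ := hG.2 v hv
  exact ⟨U, hUH, hU⟩

/-- subset sums -/
def sums (a b : E → Fin n) (S : Finset E) : Finset (Fin n → ℚ) :=
  S.powerset.image fun T => ∑ e ∈ T, edgeVec a b e

lemma mem_sums (a b : E → Fin n) (S : Finset E) (x : Fin n → ℚ) :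
    x ∈ sums a b S ↔ ∃ T ⊆ S, ∑ e ∈ T, edgeVec a b e = x := by
  simp [sums]

lemma sum_symmDiff_aux {M : Type*} [AddCommGroup M] (f : E → M) (T U : Finset E) :
    ∑ e ∈ symmDiff T U, f e = ∑ e ∈ T, f e + ∑ e ∈ U, (if e ∈ T then - f e else f e) := by
  have h1 : ∑ e ∈ symmDiff T U, f e = ∑ e ∈ T \ U, f e + ∑ e ∈ U \ T, f e := by
    rw [symmDiff_def, Finset.sup_eq_union, Finset.sum_union]
    exact disjoint_sdiff_sdiff
  have h2 : ∑ e ∈ T, f e = ∑ e ∈ T \ U, f e + ∑ e ∈ T ∩ U, f e := by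
    rw [add_comm, Finset.sum_inter_add_sum_sdiff]
  have h3 : ∑ e ∈ U, (if e ∈ T then - f e else f e)
      = ∑ e ∈ U \ T, f e - ∑ e ∈ T ∩ U, f e := by
    rw [Finset.sum_ite, Finset.sum_neg_distrib, Finset.filter_mem_eq_inter, Finset.inter_comm,
      Finset.filter_notMem_eq_sdiff]
    abel
  rw [h1, h2, h3]
  abel

lemma sums_convex (a b : E → Fin n) (S : Finset E) (e : E) (x : Fin n → ℚ) (k : ℚ) (hk : 0 < k)
    (hx : x ∈ sums a b S) (hy : x + k • edgeVec a b e ∈ sums a b S) :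
    x + edgeVec a b e ∈ sums a b S := by
  rw [mem_sums] at *
  obtain ⟨T, hT, rfl⟩ := hx
  obtain ⟨T', hT', h⟩ := hy
  let p : E → Fin n := fun f => if f ∈ T then b f else a f
  let q : E → Fin n := fun f => if f ∈ T then a f else b f
  have hpq : ∀ f, edgeVec p q f = if f ∈ T then - edgeVec a b f else edgeVec a b f := by
    intro f
    ext i
    by_cases hf : f ∈ T <;> simp [edgeVec, p, q, hf]
  have key := fun U => sum_symmDiff_aux (edgeVec a b) T U
  simp only [← hpq] at key
  obtain ⟨U, hU, hU'⟩ := exists_path p q (symmDiff T T') (a e) (b e) k hk (by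
    have h1 := key (symmDiff T T')
    rw [symmDiff_symmDiff_cancel_left, h] at h1
    have h2 := add_left_cancel h1
    intro i
    have h3 := congrFun h2 i
    rw [Finset.sum_apply] at h3
    rw [← h3]
    simp [edgeVec])
  refine ⟨symmDiff T U, ?_, ?_⟩
  · intro f hf
    rw [Finset.mem_symmDiff] at hf
    rcases hf with hf | hf
    · exact hT hf.1
    · have := hU hf.1
      rw [Finset.mem_symmDiff] at this
      rcases this with h | h
      · exact hT h.1
      · exact hT' h.1
  · rw [key]
    congr 1
    ext i
    rw [Finset.sum_apply, hU']
    rfl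

/-- contraction of the edge vector -/
def contr (u : Fin n → ℚ) (j : Fin n) : (Fin n → ℚ) →ₗ[ℚ] (Fin n → ℚ) where
  toFun x := x + x j • u
  map_add' x y := by
    ext i
    simp
    ring
  map_smul' c x := by
    ext i
    simp
    ring

lemma contr_apply (u : Fin n → ℚ) (j : Fin n) (x : Fin n → ℚ) : contr u j x = x + x j • u := rfl

lemma contr_edge (a b : E → Fin n) (e : E) (he : a e ≠ b e) (f : E) :
    contr (edgeVec a b e) (b e) (edgeVec a b f) =
      edgeVec (fun f => if a f = b e then a e else a f) (fun f => if b f = b e then a e else b f) f := by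
  ext i
  rw [contr_apply]
  simp only [edgeVec, Pi.add_apply, Pi.smul_apply, smul_eq_mul]
  by_cases h1 : a f = b e <;> by_cases h2 : b f = b e <;> simp [h1, h2]

lemma sums_contr (a b : E → Fin n) (e : E) (he : a e ≠ b e) (S : Finset E) :
    sums (fun f => if a f = b e then a e else a f) (fun f => if b f = b e then a e else b f) S =
      (sums a b S).image (contr (edgeVec a b e) (b e)) := by
  unfold sums
  rw [Finset.image_image]
  refine Finset.image_congr fun T _ => ?_
  simp only [Function.comp, map_sum, contr_edge a b e he]

lemma sums_insert (a b : E → Fin n) (e : E) (S : Finset E) (heS : e ∉ S) :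
    sums a b (insert e S) = sums a b S ∪ (sums a b S).image (· + edgeVec a b e) := by
  unfold sums
  rw [Finset.powerset_insert, Finset.image_union, Finset.image_image, Finset.image_image]
  congr 1
  refine Finset.image_congr fun T hT => ?_
  have : e ∉ T := fun h => heS (Finset.mem_powerset.1 hT h)
  simp only [Function.comp]
  rw [Finset.sum_insert this, add_comm]

lemma card_sums_insert (a b : E → Fin n) (e : E) (he : a e ≠ b e) (S : Finset E) (heS : e ∉ S) :
    (sums a b (insert e S)).card = (sums a b S).card +
      (sums (fun f => if a f = b e then a e else a f)
        (fun f => if b f = b e then a e else b f) S).card := by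
  rw [sums_insert a b e S heS, sums_contr a b e he, ← Finset.union_sdiff_self_eq_union,
    Finset.card_union_of_disjoint Finset.disjoint_sdiff]
  congr 1
  set D := sums a b S with hD
  set u := edgeVec a b e with hu
  have hub : u (b e) = -1 := by simp [hu, edgeVec, he]
  have hua : u (a e) = 1 := by simp [hu, edgeVec, he.symm]
  have hpu : ∀ x, contr u (b e) (x + u) = contr u (b e) x := by
    intro x
    ext i
    simp only [contr_apply, Pi.add_apply, Pi.smul_apply, smul_eq_mul, hub]
    ring
  have himg : D.image (contr u (b e)) = ((D.image (· + u)) \ D).image (contr u (b e)) := by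
    ext y
    simp only [Finset.mem_image, Finset.mem_sdiff]
    constructor
    · rintro ⟨x, hx, rfl⟩
      obtain ⟨z, hz, hmax⟩ := Finset.exists_max_image
        (D.filter fun z => contr u (b e) z = contr u (b e) x) (fun z => z (a e))
        ⟨x, by simp [hx]⟩
      rw [Finset.mem_filter] at hz
      refine ⟨z + u, ⟨⟨z, hz.1, rfl⟩, fun h => ?_⟩, by rw [hpu, hz.2]⟩
      have := hmax (z + u) (by rw [Finset.mem_filter]; exact ⟨h, by rw [hpu, hz.2]⟩)
      simp only [Pi.add_apply, hua] at this
      linarith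
    · rintro ⟨_, ⟨⟨x, hx, rfl⟩, -⟩, rfl⟩
      exact ⟨x, hx, (hpu x).symm⟩
  rw [himg, Finset.card_image_of_injOn]
  have aux : ∀ x ∈ D, ∀ y ∈ D, x + u ∉ D → contr u (b e) x = contr u (b e) y →
      y (b e) < x (b e) → False := by
    intro x hx y hy hxu hxy hlt
    apply hxu
    refine sums_convex a b S e x (x (b e) - y (b e)) (by linarith) hx ?_
    convert hy using 1
    rw [contr_apply, contr_apply] at hxy
    rw [sub_smul, ← hu, ← add_sub_assoc, hxy]
    abel
  intro x' hx' y' hy' hxy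
  simp only [Finset.coe_sdiff, Finset.coe_image, Set.mem_sdiff, Set.mem_image, Finset.mem_coe]
    at hx' hy'
  obtain ⟨⟨x, hx, rfl⟩, hxu⟩ := hx'
  obtain ⟨⟨y, hy, rfl⟩, hyu⟩ := hy'
  simp only [hpu] at hxy
  rcases lt_trichotomy (x (b e)) (y (b e)) with h | h | h
  · exact (aux y hy x hx hyu hxy.symm h).elim
  · rw [contr_apply, contr_apply, h] at hxy
    simpa using hxy
  · exact (aux x hx y hy hxu hxy h).elim

/-- the forests inside `S` -/
def forests (a b : E → Fin n) (S : Finset E) : Finset (Finset E) := by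
  classical exact S.powerset.filter (IsForest a b)

lemma mem_forests (a b : E → Fin n) (S F : Finset E) :
    F ∈ forests a b S ↔ F ⊆ S ∧ IsForest a b F := by
  simp [forests]

lemma isForest_iff (a b : E → Fin n) (F : Finset E) :
    IsForest a b F ↔ ∀ c : E → ℚ, ∑ e ∈ F, c e • edgeVec a b e = 0 → ∀ e ∈ F, c e = 0 :=
  linearIndepOn_finset_iff

lemma isForest_subset (a b : E → Fin n) (F G : Finset E) (h : F ⊆ G) (hG : IsForest a b G) :
    IsForest a b F :=
  LinearIndepOn.mono (v := edgeVec a b) (t := (F : Set E)) (s := (G : Set E)) hG (by exact_mod_cast h)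

lemma isForest_insert (a b : E → Fin n) (e : E) (he : a e ≠ b e) (F : Finset E) (heF : e ∉ F) :
    IsForest a b (insert e F) ↔ IsForest (fun f => if a f = b e then a e else a f)
      (fun f => if b f = b e then a e else b f) F := by
  rw [isForest_iff, isForest_iff]
  simp only [← contr_edge a b e he]
  set u := edgeVec a b e with hu
  have hub : u (b e) = -1 := by simp [hu, edgeVec, he]
  have hpu : contr u (b e) u = 0 := by
    ext i
    simp [contr_apply, hub]
  constructor
  · intro h c hc f hf
    have hc' : contr u (b e) (∑ f ∈ F, c f • edgeVec a b f) = 0 := by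
      rw [map_sum, ← hc]
      simp
    rw [contr_apply] at hc'
    have := h (Function.update c e ((∑ f ∈ F, c f • edgeVec a b f) (b e))) (by
      rw [Finset.sum_insert heF, Function.update_self]
      rw [← hc', add_comm]
      congr 1
      refine Finset.sum_congr rfl fun g hg => ?_
      rw [Function.update_of_ne]
      rintro rfl
      exact heF hg) f (Finset.mem_insert_of_mem hf)
    rwa [Function.update_of_ne] at this
    rintro rfl
    exact heF hf
  · intro h c hc
    rw [Finset.sum_insert heF] at hc
    have h1 := h c (by
      have := congrArg (contr u (b e)) hc
      rw [map_add, map_smul, hpu, map_sum] at this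
      simpa using this)
    rw [Finset.sum_eq_zero (fun f hf => by rw [h1 f hf, zero_smul]), add_zero] at hc
    have h2 := congrFun hc (b e)
    simp [← hu, hub] at h2
    intro f hf
    rcases Finset.mem_insert.1 hf with rfl | hf
    · exact h2
    · exact h1 f hf

lemma card_forests_insert (a b : E → Fin n) (e : E) (he : a e ≠ b e) (S : Finset E) (heS : e ∉ S) :
    (forests a b (insert e S)).card = (forests a b S).card +
      (forests (fun f => if a f = b e then a e else a f)
        (fun f => if b f = b e then a e else b f) S).card := by
  have h : forests a b (insert e S) = forests a b S ∪
      (forests (fun f => if a f = b e then a e else a f)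
        (fun f => if b f = b e then a e else b f) S).image (insert e) := by
    ext F
    simp only [Finset.mem_union, Finset.mem_image, mem_forests]
    constructor
    · rintro ⟨h1, h2⟩
      by_cases heF : e ∈ F
      · right
        refine ⟨F.erase e, ⟨?_, ?_⟩, Finset.insert_erase heF⟩
        · exact Finset.subset_insert_iff.1 h1
        · rw [← isForest_insert a b e he _ (Finset.notMem_erase e F), Finset.insert_erase heF]
          exact h2
      · left
        exact ⟨(Finset.subset_insert_iff_of_notMem heF).1 h1, h2⟩
    · rintro (⟨h1, h2⟩ | ⟨G, ⟨h1, h2⟩, rfl⟩)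
      · exact ⟨h1.trans (Finset.subset_insert _ _), h2⟩
      · exact ⟨Finset.insert_subset_insert _ h1,
          (isForest_insert a b e he G (fun h => heS (h1 h))).2 h2⟩
  rw [h, Finset.card_union_of_disjoint, Finset.card_image_of_injOn]
  · intro F hF G hG hFG
    rw [Finset.mem_coe, mem_forests] at hF hG
    rw [← Finset.erase_insert (fun h => heS (hF.1 h)), ← Finset.erase_insert (fun h => heS (hG.1 h))]
    exact congrArg (fun X => Finset.erase X e) hFG
  · rw [Finset.disjoint_left]
    intro F hF hF'
    rw [mem_forests] at hF
    obtain ⟨G, -, rfl⟩ := Finset.mem_image.1 hF'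
    exact heS (hF.1 (Finset.mem_insert_self _ _))

lemma card_forests_eq_card_sums (S : Finset E) : ∀ a b : E → Fin n,
    (forests a b S).card = (sums a b S).card := by
  induction S using Finset.induction_on with
  | empty =>
    intro a b
    have h1 : forests a b ∅ = {∅} := by
      ext F
      rw [mem_forests, isForest_iff]
      constructor
      · rintro ⟨h, -⟩
        simpa using h
      · intro h
        rw [Finset.mem_singleton] at h
        subst h
        simp
    rw [h1]
    simp [sums]
  | insert e S heS ih =>
    intro a b
    by_cases he : a e = b e
    · have hz : edgeVec a b e = 0 := by
        ext i
        simp [edgeVec, he]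
      have h1 : forests a b (insert e S) = forests a b S := by
        ext F
        rw [mem_forests, mem_forests]
        constructor
        · rintro ⟨h1, h2⟩
          refine ⟨(Finset.subset_insert_iff_of_notMem fun heF => ?_).1 h1, h2⟩
          have h3 := (isForest_iff a b F).1 h2 (Pi.single e 1) (by
            refine Finset.sum_eq_zero fun f _ => ?_
            by_cases hf : f = e
            · rw [hf, hz, smul_zero]
            · rw [Pi.single_eq_of_ne hf, zero_smul]) e heF
          simp at h3
        · rintro ⟨h1, h2⟩
          exact ⟨h1.trans (Finset.subset_insert _ _), h2⟩
      rw [h1, sums_insert a b e S heS, hz, ih]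
      simp
    · rw [card_forests_insert a b e he S heS, card_sums_insert a b e he S heS, ih, ih]

end Helpers

/-- The number of spanning forests of a loopless graph equals the number of
distinct in-degree vectors arising from its orientations. -/
theorem card_forests_eq_card_indegree_vectors
    {n : ℕ} {E : Type*} [Fintype E] [DecidableEq E]
    (a b : E → Fin n) (hab : ∀ e, a e < b e) :
    Set.ncard {F : Finset E | IsForest a b F} =
      Set.ncard {d : Fin n → ℕ | ∃ o : E → Bool,
        d = fun i => (Finset.univ.filter fun e => head a b o e = i).card} := by
  classical
  have h1 : {F : Finset E | IsForest a b F} = (forests a b Finset.univ : Set (Finset E)) := by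
    ext F
    simp [mem_forests]
  rw [h1, Set.ncard_coe_finset, card_forests_eq_card_sums, ← Set.ncard_coe_finset]
  let Φ : (Fin n → ℕ) → (Fin n → ℚ) := fun d i =>
    (d i : ℚ) - ∑ e : E, (if b e = i then (1:ℚ) else 0)
  have hΦ : Function.Injective Φ := by
    intro d d' h
    ext i
    have := congrFun h i
    simpa [Φ] using this
  rw [← Set.ncard_image_of_injective _ hΦ]
  congr 1
  have key : ∀ o : E → Bool, Φ (fun i => (Finset.univ.filter fun e => head a b o e = i).card) =
      ∑ e ∈ Finset.univ.filter (fun e => o e = true), edgeVec a b e := by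
    intro o
    ext i
    simp only [Φ]
    rw [Finset.card_filter, Finset.sum_apply, Finset.sum_filter, Nat.cast_sum,
      ← Finset.sum_sub_distrib]
    refine Finset.sum_congr rfl fun e _ => ?_
    by_cases h : o e = true <;> simp [head, edgeVec, h]
  ext x
  rw [Finset.mem_coe, mem_sums]
  constructor
  · rintro ⟨T, -, rfl⟩
    refine ⟨_, ⟨fun e => decide (e ∈ T), rfl⟩, ?_⟩
    rw [key]
    simp
  · rintro ⟨_, ⟨o, rfl⟩, rfl⟩
    exact ⟨_, Finset.subset_univ _, (key o).symm⟩


end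
end

section
/- Let G be a loopless graph and let q ∈ K, with Hecke parameters q_e = q for all edges e. Then the Hilbert polynomial of Ψ_{G,q} coincides with that of the undeformed algebra C_G = Ψ_{G,0}: for every k ∈ ℕ, dim_K F_k(Ψ_{G,q}) = dim_K F_k(Ψ_{G,0}). -/
open MvPolynomial

set_option synthInstance.maxHeartbeats 1000000
set_option maxHeartbeats 1000000

noncomputable section

/-- The `k`-th piece of the filtration of `Ψ_{G,Q}` induced by the generators `X_i`. -/
def Fk (K : Type*) [Field K] {n : ℕ} {E : Type*} [Fintype E]
    (a b : E → Fin n) (q : E → K) (k : ℕ) : Submodule K (PhiAlg K E q) :=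
  Submodule.span K
    {y | ∃ α : Fin n → ℕ, (∑ i, α i) ≤ k ∧ y = ∏ i, (XX K a b q i) ^ (α i)}

/-! ### Combinatorics of score vectors -/

/-- The score vector of a set of edges. -/
def scoreV {V E : Type*} [DecidableEq V] (a b : E → V) (S : Finset E) : V → ℤ :=
  ∑ e ∈ S, (Pi.single (a e) 1 - Pi.single (b e) 1)

/-- The set of score vectors of subsets of `T`. -/
def scoreSet {V E : Type*} [DecidableEq V] [Fintype V] (a b : E → V) (T : Finset E) :
    Finset (V → ℤ) :=
  T.powerset.image (scoreV a b)

/-- Extraction of a path in a flow. -/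
lemma path_extract {V E : Type*} [DecidableEq V] [DecidableEq E] (s t : E → V) (z : V) :
    ∀ (m : ℕ) (T : Finset E), T.card = m → ∀ y : V, y ≠ z →
      (∀ x, x ≠ z → (if x = y then 1 else 0) ≤ scoreV s t T x) →
      ∃ T' ⊆ T, scoreV s t T' = Pi.single y 1 - Pi.single z 1 := by
  intro m
  induction m with
  | zero =>
    intro T hT y hy h
    have := h y hy
    rw [Finset.card_eq_zero] at hT
    subst hT
    simp [scoreV] at this
  | succ m ih =>
    intro T hT y hy h
    have h1 : ∃ e ∈ T, s e = y ∧ t e ≠ y := by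
      by_contra hcon
      push Not at hcon
      have h2 := h y hy
      have h3 : scoreV s t T y ≤ 0 := by
        simp only [scoreV, Finset.sum_apply, Pi.sub_apply]
        apply Finset.sum_nonpos
        intro e he
        by_cases hs : s e = y
        · rw [hcon e he hs, hs]; simp
        · simp only [Pi.single_apply]
          rw [if_neg (fun h => hs h.symm)]
          split_ifs <;> simp
      simp at h2
      omega
    obtain ⟨e, he, hs, ht⟩ := h1
    by_cases hz : t e = z
    · refine ⟨{e}, by simpa using he, ?_⟩
      simp [scoreV, hs, hz]
    · have hsum : scoreV s t T = (Pi.single (s e) 1 - Pi.single (t e) 1) + scoreV s t (T.erase e) :=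
        (Finset.add_sum_erase T _ he).symm
      obtain ⟨T', hT', hT2⟩ := ih (T.erase e) (by rw [Finset.card_erase_of_mem he, hT]; rfl)
        (t e) hz (by
          intro x hx
          have := h x hx
          rw [hsum, hs] at this
          simp only [Pi.add_apply, Pi.sub_apply, Pi.single_apply] at this
          have h0 : 0 ≤ (if x = y then (1:ℤ) else 0) := by split_ifs <;> simp
          linarith)
      have heT : e ∉ T' := fun h => by simpa using hT' h
      refine ⟨insert e T', ?_, ?_⟩
      · intro x hx
        rcases Finset.mem_insert.1 hx with rfl | hx
        · exact he
        · exact Finset.mem_of_mem_erase (hT' hx)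
      · have : scoreV s t (insert e T') = (Pi.single (s e) 1 - Pi.single (t e) 1) + scoreV s t T' :=
          Finset.sum_insert heT
        rw [this, hT2, hs]
        abel

lemma score_step {V E : Type*} [DecidableEq V] [Fintype V] [DecidableEq E] (a b : E → V)
    (T : Finset E) (p p' : V → ℤ) (hp : p ∈ scoreSet a b T) (hp' : p' ∈ scoreSet a b T)
    (y z : V) (hyz : y ≠ z)
    (h : ∀ x, x ≠ z → (if x = y then 1 else 0) ≤ p' x - p x) :
    p + (Pi.single y 1 - Pi.single z 1) ∈ scoreSet a b T := by
  simp only [scoreSet, Finset.mem_image, Finset.mem_powerset] at hp hp' ⊢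
  obtain ⟨S, hS, rfl⟩ := hp
  obtain ⟨S', hS', rfl⟩ := hp'
  set s : E → V := fun e => if e ∈ S then b e else a e with hs
  set t : E → V := fun e => if e ∈ S then a e else b e with ht
  have key1 : ∀ U : Finset E, scoreV s t U = scoreV a b (U \ S) - scoreV a b (U ∩ S) := by
    intro U
    have : scoreV s t U = scoreV s t (U \ S) + scoreV s t (U ∩ S) := by
      simp only [scoreV]
      rw [add_comm, Finset.sum_inter_add_sum_sdiff]
    rw [this, sub_eq_add_neg]
    congr 1
    · apply Finset.sum_congr rfl
      intro e he
      simp [hs, ht, (Finset.mem_sdiff.1 he).2]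
    · simp only [scoreV]
      rw [← Finset.sum_neg_distrib]
      apply Finset.sum_congr rfl
      intro e he
      simp [hs, ht, (Finset.mem_inter.1 he).2]
  have key2 : ∀ A B : Finset E, scoreV a b A = scoreV a b (A \ B) + scoreV a b (A ∩ B) := by
    intro A B
    simp only [scoreV]
    rw [add_comm, Finset.sum_inter_add_sum_sdiff]
  have e1 : scoreV s t ((S' \ S) ∪ (S \ S')) = scoreV a b S' - scoreV a b S := by
    rw [key1, key2 S' S, key2 S S']
    have i1 : ((S' \ S) ∪ (S \ S')) \ S = S' \ S := by grind
    have i2 : ((S' \ S) ∪ (S \ S')) ∩ S = S \ S' := by grind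
    rw [i1, i2, Finset.inter_comm S S']
    abel
  obtain ⟨T', hT', hT2⟩ := path_extract s t z _ ((S' \ S) ∪ (S \ S')) rfl y hyz (by
    intro x hx
    rw [e1]
    exact h x hx)
  refine ⟨(S \ T') ∪ (T' \ S), ?_, ?_⟩
  · intro x hx
    rcases Finset.mem_union.1 hx with hx | hx
    · exact hS (Finset.mem_sdiff.1 hx).1
    · have := hT' (Finset.mem_sdiff.1 hx).1
      rcases Finset.mem_union.1 this with h | h
      · exact hS' (Finset.mem_sdiff.1 h).1
      · exact hS (Finset.mem_sdiff.1 h).1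
  · rw [← hT2, key1, key2 S T']
    have : scoreV a b (S \ T' ∪ T' \ S) = scoreV a b (S \ T') + scoreV a b (T' \ S) :=
      Finset.sum_union (by
        rw [Finset.disjoint_left]; intro x hx hx'
        exact (Finset.mem_sdiff.1 hx).2 (Finset.mem_sdiff.1 hx').1)
    rw [this, Finset.inter_comm S T']
    abel

/-- contraction of `z` to `y` on vertices. -/
def ctr {V : Type*} [DecidableEq V] (y z : V) (x : V) : V := if x = z then y else x

/-- push-forward of vectors under contraction -/
def ctrPush {V : Type*} [DecidableEq V] (y z : V) : (V → ℤ) →+ (V → ℤ) where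
  toFun p := fun x => if x = z then 0 else if x = y then p y + p z else p x
  map_zero' := by ext x; simp
  map_add' p p' := by
    ext x
    simp only [Pi.add_apply]
    split_ifs <;> ring

lemma ctrPush_single {V : Type*} [DecidableEq V] (y z : V) (hyz : y ≠ z) (x : V) :
    ctrPush y z (Pi.single x 1) = Pi.single (ctr y z x) 1 := by
  ext w
  simp only [ctrPush, ctr, AddMonoidHom.coe_mk, ZeroHom.coe_mk, Pi.single_apply]
  by_cases h1 : w = z <;> by_cases h2 : w = y <;> by_cases h3 : x = z <;> by_cases h4 : x = y <;>
    grind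

lemma ctrPush_score {V E : Type*} [DecidableEq V] (a b : E → V) (y z : V) (hyz : y ≠ z)
    (S : Finset E) :
    ctrPush y z (scoreV a b S) = scoreV (ctr y z ∘ a) (ctr y z ∘ b) S := by
  simp only [scoreV, map_sum, map_sub, ctrPush_single y z hyz, Function.comp]

lemma card_scoreSet_insert {V E : Type*} [DecidableEq V] [Fintype V] [DecidableEq E] (a b : E → V)
    (T : Finset E) (e : E) (he : e ∉ T) (hab : a e ≠ b e) :
    (scoreSet a b (insert e T)).card ≤ (scoreSet a b T).card +
      (scoreSet (ctr (a e) (b e) ∘ a) (ctr (a e) (b e) ∘ b) T).card := by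
  set v : V → ℤ := Pi.single (a e) 1 - Pi.single (b e) 1 with hv
  set N := (scoreSet a b T).filter (fun p => p + v ∉ scoreSet a b T) with hN
  have hsub : scoreSet a b (insert e T) ⊆ scoreSet a b T ∪ N.image (fun p => p + v) := by
    intro p hp
    simp only [scoreSet, Finset.mem_image, Finset.mem_powerset] at hp
    obtain ⟨S, hS, rfl⟩ := hp
    by_cases heS : e ∈ S
    · have h1 : scoreV a b S = scoreV a b (S.erase e) + v :=
        (Finset.sum_erase_add S _ heS).symm
      have h2 : scoreV a b (S.erase e) ∈ scoreSet a b T := by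
        apply Finset.mem_image_of_mem
        rw [Finset.mem_powerset]
        grind
      by_cases h3 : scoreV a b S ∈ scoreSet a b T
      · exact Finset.mem_union_left _ h3
      · apply Finset.mem_union_right
        rw [Finset.mem_image]
        refine ⟨_, Finset.mem_filter.2 ⟨h2, ?_⟩, h1.symm⟩
        rwa [← h1]
    · apply Finset.mem_union_left
      apply Finset.mem_image_of_mem
      rw [Finset.mem_powerset]
      grind
  have hcard : N.card ≤ (scoreSet (ctr (a e) (b e) ∘ a) (ctr (a e) (b e) ∘ b) T).card := by
    apply Finset.card_le_card_of_injOn (ctrPush (a e) (b e))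
    · intro p hp
      have hp1 := (Finset.mem_filter.1 hp).1
      simp only [scoreSet, Finset.mem_image, Finset.mem_powerset] at hp1
      obtain ⟨S, hS, rfl⟩ := hp1
      rw [ctrPush_score _ _ _ _ hab]
      exact Finset.mem_image_of_mem _ (Finset.mem_powerset.2 hS)
    · intro p hp p' hp' heq
      obtain ⟨hp1, hp2⟩ := Finset.mem_filter.1 hp
      obtain ⟨hp1', hp2'⟩ := Finset.mem_filter.1 hp'
      have hx : ∀ x, x ≠ a e → x ≠ b e → p x = p' x := by
        intro x h1 h2
        have := congrFun heq x
        simpa [ctrPush, h1, h2] using this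
      have hs : p (a e) + p (b e) = p' (a e) + p' (b e) := by
        have := congrFun heq (a e)
        simpa [ctrPush, hab] using this
      rcases lt_trichotomy (p (a e)) (p' (a e)) with h | h | h
      · exact absurd (score_step a b T p p' hp1 hp1' (a e) (b e) hab (by
          intro x hxb
          split_ifs with hxa
          · subst hxa; omega
          · rw [hx x hxa hxb]; simp)) hp2
      · ext x
        by_cases h1 : x = a e
        · rw [h1, h]
        · by_cases h2 : x = b e
          · rw [h2]; omega
          · exact hx x h1 h2
      · exact absurd (score_step a b T p' p hp1' hp1 (a e) (b e) hab (by
          intro x hxb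
          split_ifs with hxa
          · subst hxa; omega
          · rw [hx x hxa hxb]; simp)) hp2'
  refine (Finset.card_le_card hsub).trans ((Finset.card_union_le _ _).trans ?_)
  refine Nat.add_le_add_left ?_ _
  exact (Finset.card_image_le (s := N) (f := fun p => p + v)).trans hcard

lemma card_scoreSet_insert_loop {V E : Type*} [DecidableEq V] [Fintype V] [DecidableEq E]
    (a b : E → V) (T : Finset E) (e : E) (hab : a e = b e) :
    (scoreSet a b (insert e T)).card ≤ (scoreSet a b T).card := by
  apply Finset.card_le_card
  intro p hp
  simp only [scoreSet, Finset.mem_image, Finset.mem_powerset] at hp ⊢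
  obtain ⟨S, hS, rfl⟩ := hp
  refine ⟨S.erase e, by grind, ?_⟩
  exact Finset.sum_erase S (by simp [hab])

/-! ### The space spanned by edge products -/

/-- product of the linear forms of the edges in `S` -/
def edgeProd (K : Type*) [Field K] {V E : Type*} (a b : E → V) (S : Finset E) :
    MvPolynomial V K := ∏ e ∈ S, (X (a e) - X (b e))

/-- span of the edge products -/
def edgeSpan (K : Type*) [Field K] {V E : Type*} (a b : E → V) (T : Finset E) :
    Submodule K (MvPolynomial V K) :=
  Submodule.span K (Set.image (edgeProd K a b) (T.powerset : Set (Finset E)))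

instance edgeSpan_fin (K : Type*) [Field K] {V E : Type*} (a b : E → V) (T : Finset E) :
    FiniteDimensional K (edgeSpan K a b T) :=
  FiniteDimensional.span_of_finite K ((Finset.finite_toSet _).image _)

lemma finrank_map_add_le {K M N : Type*} [Field K] [AddCommGroup M] [Module K M]
    [AddCommGroup N] [Module K N] (f : M →ₗ[K] N) (A B : Submodule K M) [FiniteDimensional K A]
    (hB : B ≤ A) (hf : ∀ x ∈ B, f x = 0) :
    Module.finrank K (A.map f) + Module.finrank K B ≤ Module.finrank K A := by
  have h := (f.domRestrict A).finrank_range_add_finrank_ker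
  rw [LinearMap.range_domRestrict] at h
  rw [← h]
  gcongr
  have : B.comap A.subtype ≤ LinearMap.ker (f.domRestrict A) := by
    intro x hx
    exact hf _ hx
  calc _ = Module.finrank K (B.comap A.subtype) :=
        (LinearEquiv.finrank_eq (Submodule.comapSubtypeEquivOfLe hB)).symm
    _ ≤ _ := Submodule.finrank_mono this

lemma card_scoreSet_le {K : Type*} [Field K] {V E : Type*} [DecidableEq V] [Fintype V]
    [DecidableEq E] (T : Finset E) : ∀ (a b : E → V),
    (scoreSet a b T).card ≤ Module.finrank K (edgeSpan K a b T) := by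
  induction T using Finset.induction_on with
  | empty =>
    intro a b
    have h1 : (scoreSet a b ∅).card = 1 := by simp [scoreSet]
    have h2 : edgeSpan K a b ∅ = Submodule.span K {1} := by simp [edgeSpan, edgeProd]
    rw [h1, h2, finrank_span_singleton one_ne_zero]
  | insert e T he ih =>
    intro a b
    have hmono : edgeSpan K a b T ≤ edgeSpan K a b (insert e T) := by
      apply Submodule.span_mono
      apply Set.image_mono
      exact Finset.coe_subset.2 (Finset.powerset_mono.2 (Finset.subset_insert e T))
    by_cases hab : a e = b e
    · exact (card_scoreSet_insert_loop a b T e hab).trans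
        ((ih a b).trans (Submodule.finrank_mono hmono))
    · refine (card_scoreSet_insert a b T e he hab).trans ?_
      refine (Nat.add_le_add (ih _ _) (ih _ _)).trans ?_
      set v : MvPolynomial V K := X (a e) - X (b e) with hv
      have hv0 : v ≠ 0 := by
        rw [hv, sub_ne_zero]
        intro h
        exact hab (MvPolynomial.X_injective h)
      set μ : MvPolynomial V K →ₗ[K] MvPolynomial V K := LinearMap.mulLeft K v with hμ
      have hμi : Function.Injective μ := by
        intro x y hxy
        exact mul_left_cancel₀ hv0 hxy
      have hsub : (edgeSpan K a b T).map μ ≤ edgeSpan K a b (insert e T) := by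
        rw [edgeSpan, Submodule.map_span, Submodule.span_le]
        rintro _ ⟨_, ⟨S, hS, rfl⟩, rfl⟩
        apply Submodule.subset_span
        have hS' : S ⊆ T := Finset.mem_powerset.1 (Finset.mem_coe.1 hS)
        refine ⟨insert e S, ?_, ?_⟩
        · exact Finset.mem_coe.2 (Finset.mem_powerset.2 (Finset.insert_subset_insert e hS'))
        · exact Finset.prod_insert (fun h => he (hS' h))
      set ρ : MvPolynomial V K →ₗ[K] MvPolynomial V K :=
        (rename (ctr (a e) (b e)) : MvPolynomial V K →ₐ[K] MvPolynomial V K).toLinearMap with hρ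
      have h := finrank_map_add_le ρ (edgeSpan K a b (insert e T)) ((edgeSpan K a b T).map μ) hsub
        (by
          rintro _ ⟨x, _, rfl⟩
          have h1 : rename (ctr (a e) (b e)) v = 0 := by
            simp [hv, ctr, hab]
          simp [hρ, hμ, h1])
      rw [← (Submodule.equivMapOfInjective μ hμi (edgeSpan K a b T)).finrank_eq] at h
      refine le_trans ?_ h
      rw [add_comm]
      gcongr
      apply Submodule.finrank_mono
      rw [edgeSpan, Submodule.span_le]
      rintro _ ⟨S, hS, rfl⟩
      refine ⟨edgeProd K a b S, hmono (Submodule.subset_span ⟨S, hS, rfl⟩), ?_⟩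
      simp [hρ, edgeProd, map_prod]

/-! ### Coefficients of squarefree monomials -/

/-- indicator exponent of a finset -/
def indS {E : Type*} (S : Finset E) : E →₀ ℕ := ∑ e ∈ S, Finsupp.single e 1

lemma indS_apply {E : Type*} [DecidableEq E] (S : Finset E) (e : E) :
    indS S e = if e ∈ S then 1 else 0 := by
  simp [indS, Finsupp.finsetSum_apply, Finsupp.single_apply]

lemma indS_support {E : Type*} [DecidableEq E] (S : Finset E) : (indS S).support = S := by
  ext e
  simp [indS_apply]

lemma indS_degree {E : Type*} [DecidableEq E] (S : Finset E) : (indS S).degree = S.card := by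
  simp [indS, map_sum]

lemma indS_sub {E : Type*} [DecidableEq E] (S : Finset E) (e : E) (he : e ∈ S) :
    indS S - Finsupp.single e 1 = indS (S.erase e) := by
  ext x
  simp only [Finsupp.coe_tsub, Pi.sub_apply, indS_apply, Finsupp.single_apply]
  grind

lemma card_support_le_degree {E : Type*} (m : E →₀ ℕ) : m.support.card ≤ m.degree := by
  rw [Finsupp.degree_apply, Finset.card_eq_sum_ones]
  apply Finset.sum_le_sum
  intro e he
  have := Finsupp.mem_support_iff.1 he
  omega

lemma eq_indS {E : Type*} [DecidableEq E] (m : E →₀ ℕ) (h : m.degree ≤ m.support.card) :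
    m = indS m.support := by
  have h1 : ∀ e ∈ m.support, 1 ≤ m e := by
    intro e he
    have := Finsupp.mem_support_iff.1 he
    omega
  have h2 : ∑ e ∈ m.support, 1 = ∑ e ∈ m.support, m e := by
    apply le_antisymm (Finset.sum_le_sum h1)
    rw [Finset.sum_const, smul_eq_mul, mul_one]
    rwa [Finsupp.degree_apply] at h
  have h3 := (Finset.sum_eq_sum_iff_of_le h1).1 h2
  ext e
  rw [indS_apply]
  split_ifs with he
  · exact (h3 e he).symm
  · exact Finsupp.notMem_support_iff.1 he

/-- the coefficient functional of `u_S` on the deformed algebra, upstairs -/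
def Lq {K : Type*} [Field K] {E : Type*} [DecidableEq E] (q : K) (S : Finset E) :
    MvPolynomial E K →ₗ[K] K :=
  (basisMonomials E K).constr K (fun m => if m.support = S then q ^ (m.degree - S.card) else 0)

lemma Lq_monomial {K : Type*} [Field K] {E : Type*} [DecidableEq E] (q : K) (S : Finset E)
    (m : E →₀ ℕ) (c : K) :
    Lq q S (monomial m c) = c * if m.support = S then q ^ (m.degree - S.card) else 0 := by
  have h : monomial m c = c • (basisMonomials E K m) := by
    simp [coe_basisMonomials, smul_monomial]
  rw [h, map_smul, Lq, Module.Basis.constr_basis, smul_eq_mul]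

lemma Lq_rel {K : Type*} [Field K] {E : Type*} [DecidableEq E] (q : K) (S : Finset E)
    (p : MvPolynomial E K) (hp : p ∈ relIdeal K E (fun _ => q)) : Lq q S p = 0 := by
  suffices h : ∀ r, Lq q S (r * p) = 0 by simpa using h 1
  induction hp using Submodule.span_induction with
  | mem x hx =>
    obtain ⟨e, rfl⟩ := hx
    intro r
    induction r using MvPolynomial.induction_on' with
    | monomial m c =>
      have h1 : monomial m c * ((X e) ^ 2 - C q * X e) =
          monomial (m + Finsupp.single e 2) c - monomial (m + Finsupp.single e 1) (c * q) := by
        rw [X_pow_eq_monomial, X, C_mul_monomial, mul_sub, monomial_mul, monomial_mul, mul_one,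
          mul_one]
      have hs : (m + Finsupp.single e 2).support = (m + Finsupp.single e 1).support := by
        ext x
        simp only [Finsupp.mem_support_iff, Finsupp.coe_add, Pi.add_apply, Finsupp.single_apply]
        split_ifs <;> simp
      rw [h1, map_sub, Lq_monomial, Lq_monomial, hs]
      split_ifs with h2
      · have h3 := card_support_le_degree (m + Finsupp.single e 1)
        rw [h2] at h3
        have h4 : (m + Finsupp.single e 2).degree = (m + Finsupp.single e 1).degree + 1 := by
          simp [add_assoc]
        rw [h4, Nat.succ_sub h3, pow_succ]
        ring
      · simp
    | add r s hr hs => rw [add_mul, map_add, hr, hs, add_zero]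
  | zero => simp
  | add x y _ _ hx hy => intro r; rw [mul_add, map_add, hx, hy, add_zero]
  | smul c x _ hx => intro r; rw [smul_eq_mul, ← mul_assoc, hx]

/-- descended functional -/
def Lbar {K : Type*} [Field K] {E : Type*} [DecidableEq E] (q : K) (S : Finset E) :
    PhiAlg K E (fun _ => q) →ₗ[K] K :=
  Submodule.liftQ ((relIdeal K E (fun _ => q)).restrictScalars K) (Lq q S)
    (fun p hp => Lq_rel q S p hp)

lemma Lbar_mk {K : Type*} [Field K] {E : Type*} [DecidableEq E] (q : K) (S : Finset E)
    (p : MvPolynomial E K) :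
    Lbar q S (Ideal.Quotient.mk (relIdeal K E (fun _ => q)) p) = Lq q S p := rfl

lemma Lq_eq_coeff {K : Type*} [Field K] {E : Type*} [DecidableEq E] (q : K) (S : Finset E)
    (p : MvPolynomial E K) (hp : ∀ m ∈ p.support, m.degree ≤ S.card ∨ q = 0) :
    Lq q S p = coeff (indS S) p := by
  conv_lhs => rw [p.as_sum]
  conv_rhs => rw [p.as_sum]
  rw [map_sum, coeff_sum]
  apply Finset.sum_congr rfl
  intro m hm
  rw [Lq_monomial, coeff_monomial]
  by_cases h : m = indS S
  · rw [if_pos h, h, indS_support, indS_degree]; simp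
  · rw [if_neg h]
    by_cases h2 : m.support = S
    · have h3 : ¬ m.degree ≤ S.card := by
        intro h4
        apply h
        rw [← h2] at h4 ⊢
        exact eq_indS m h4
      have hq := (hp m hm).resolve_left h3
      rw [if_pos h2, hq, zero_pow (by omega), mul_zero]
    · rw [if_neg h2, mul_zero]

lemma Lq_hom {K : Type*} [Field K] {E : Type*} [DecidableEq E] (q : K) (S : Finset E)
    (p : MvPolynomial E K) (d : ℕ) (hp : p.IsHomogeneous d) (hd : d ≤ S.card) :
    Lq q S p = coeff (indS S) p := by
  apply Lq_eq_coeff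
  intro m hm
  left
  have hmd : m.degree = d := by
    rw [Finsupp.degree_eq_weight_one]; exact hp (mem_support_iff.1 hm)
  exact hmd.trans_le hd

lemma Lq_zero {K : Type*} [Field K] {E : Type*} [DecidableEq E] (S : Finset E)
    (p : MvPolynomial E K) : Lq 0 S p = coeff (indS S) p :=
  Lq_eq_coeff _ _ _ (fun _ _ => Or.inr rfl)

lemma hom_mem_rel {K : Type*} [Field K] {E : Type*} [DecidableEq E] 
    (p : MvPolynomial E K) (d : ℕ) (hp : p.IsHomogeneous d)
    (h : ∀ S : Finset E, S.card = d → coeff (indS S) p = 0) :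
    p ∈ relIdeal K E (fun _ => (0 : K)) := by
  rw [p.as_sum]
  apply Ideal.sum_mem
  intro m hm
  have hmd : m.degree = d := by
    rw [Finsupp.degree_eq_weight_one]; exact hp (mem_support_iff.1 hm)
  by_cases h1 : m.degree ≤ m.support.card
  · exfalso
    have h2 := eq_indS m h1
    have h3 := h m.support (le_antisymm ((card_support_le_degree m).trans hmd.le) (hmd ▸ h1))
    rw [← h2] at h3
    exact mem_support_iff.1 hm h3
  · have : ∃ e, 2 ≤ m e := by
      by_contra hcon
      push Not at hcon
      apply h1
      rw [Finsupp.degree_apply, Finset.card_eq_sum_ones]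
      apply Finset.sum_le_sum
      intro e _
      have := hcon e
      omega
    obtain ⟨e, he⟩ := this
    have hm2 : m = (m - Finsupp.single e 2) + Finsupp.single e 2 := by
      rw [tsub_add_cancel_of_le]
      rwa [Finsupp.single_le_iff]
    have : monomial m (coeff m p) = monomial (m - Finsupp.single e 2) (coeff m p) *
        ((X e) ^ 2 - C (0 : K) * X e) := by
      rw [C_0, zero_mul, sub_zero, X_pow_eq_monomial, monomial_mul, mul_one, ← hm2]
    rw [this]
    apply Ideal.mul_mem_left
    exact Ideal.subset_span ⟨e, rfl⟩

/-! ### The linear forms -/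

/-- lift of `X_i` to the polynomial ring -/
def lin (K : Type*) [Field K] {n : ℕ} {E : Type*} [Fintype E]
    (a b : E → Fin n) (i : Fin n) : MvPolynomial E K :=
  (∑ e ∈ Finset.univ.filter fun e => a e = i, X e) -
      ∑ e ∈ Finset.univ.filter fun e => b e = i, X e

/-- coefficients of the incidence matrix -/
def inc (K : Type*) [Field K] {n : ℕ} {E : Type*} (a b : E → Fin n) (e : E) (i : Fin n) : K :=
  (if a e = i then 1 else 0) - (if b e = i then 1 else 0)

lemma lin_eq {K : Type*} [Field K] {n : ℕ} {E : Type*} [Fintype E]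
    (a b : E → Fin n) (i : Fin n) : lin K a b i = ∑ e, C (inc K a b e i) * X e := by
  simp only [lin, inc, Finset.sum_filter, ← Finset.sum_sub_distrib]
  apply Finset.sum_congr rfl
  intro e _
  split_ifs <;> simp

lemma lin_hom {K : Type*} [Field K] {n : ℕ} {E : Type*} [Fintype E]
    (a b : E → Fin n) (i : Fin n) : (lin K a b i).IsHomogeneous 1 := by
  rw [lin]
  exact (IsHomogeneous.sum _ _ _ (fun e _ => isHomogeneous_X _ _)).sub
    (IsHomogeneous.sum _ _ _ (fun e _ => isHomogeneous_X _ _))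

lemma coeff_lin_mul {K : Type*} [Field K] {n : ℕ} {E : Type*} [Fintype E] [DecidableEq E]
    (a b : E → Fin n) (i : Fin n) (S : Finset E) (p : MvPolynomial E K) :
    coeff (indS S) (lin K a b i * p) = ∑ e ∈ S, inc K a b e i * coeff (indS (S.erase e)) p := by
  rw [lin_eq, Finset.sum_mul, coeff_sum]
  rw [← Finset.sum_subset (Finset.subset_univ S)]
  · apply Finset.sum_congr rfl
    intro e he
    rw [mul_assoc, coeff_C_mul, coeff_X_mul', indS_support, if_pos he, indS_sub S e he]
  · intro e _ he
    rw [mul_assoc, coeff_C_mul, coeff_X_mul', indS_support, if_neg he, mul_zero]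

lemma pderiv_edgeProd {K : Type*} [Field K] {n : ℕ} {E : Type*} [DecidableEq E]
    (a b : E → Fin n) (i : Fin n) (S : Finset E) :
    pderiv i (edgeProd K a b S) = ∑ e ∈ S, C (inc K a b e i) * edgeProd K a b (S.erase e) := by
  induction S using Finset.induction_on with
  | empty => simp [edgeProd]
  | insert e S he ih =>
    have h1 : edgeProd K a b (insert e S) = (X (a e) - X (b e)) * edgeProd K a b S :=
      Finset.prod_insert he
    have h2 : pderiv i (X (a e) - X (b e) : MvPolynomial (Fin n) K) = C (inc K a b e i) := by
      rw [map_sub, pderiv_X, pderiv_X, inc]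
      simp only [Pi.single_apply]
      split_ifs <;> simp_all
    rw [h1, pderiv_mul, h2, ih, Finset.sum_insert he, Finset.erase_insert he, Finset.mul_sum]
    congr 1
    apply Finset.sum_congr rfl
    intro e' he'
    have hne : e ≠ e' := fun h => he (h ▸ he')
    rw [Finset.erase_insert_of_ne hne]
    have h3 : edgeProd K a b (insert e (S.erase e')) =
        (X (a e) - X (b e)) * edgeProd K a b (S.erase e') :=
      Finset.prod_insert (fun h => he (Finset.mem_of_mem_erase h))
    rw [h3]
    ring

lemma coeff_duality {K : Type*} [Field K] [CharZero K] {n : ℕ} {E : Type*} [Fintype E]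
    [DecidableEq E] (a b : E → Fin n) : ∀ (d : ℕ) (α : Fin n →₀ ℕ), α.degree = d →
    ∃ c : K, c ≠ 0 ∧ ∀ S : Finset E, coeff (indS S) (aeval (lin K a b) (monomial α (1 : K))) =
      c * coeff α (edgeProd K a b S) := by
  intro d
  induction d with
  | zero =>
    intro α hα
    have hα0 : α = 0 := (Finsupp.degree_eq_zero_iff α).1 hα
    subst hα0
    refine ⟨1, one_ne_zero, fun S => ?_⟩
    have h1 : coeff 0 (edgeProd K a b S) = ∏ e ∈ S, (0 : K) := by
      rw [← constantCoeff_eq, edgeProd, map_prod]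
      simp
    rw [h1, one_mul]
    have h2 : aeval (lin K a b) (monomial (0 : Fin n →₀ ℕ) (1 : K)) = 1 := by
      have : monomial (0 : Fin n →₀ ℕ) (1 : K) = 1 := rfl
      rw [this, map_one]
    rw [h2, coeff_one, Finset.prod_const]
    by_cases hS : S = ∅
    · subst hS; simp [indS]
    · rw [zero_pow (by simpa using hS), if_neg]
      intro h
      apply hS
      rw [← indS_support S, ← h]; simp
  | succ d ih =>
    intro α hα
    have : ∃ i, α i ≠ 0 := by
      by_contra hcon
      push Not at hcon
      have : α = 0 := by ext i; exact hcon i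
      subst this
      simp at hα
    obtain ⟨i, hi⟩ := this
    obtain ⟨β, rfl⟩ : ∃ β : Fin n →₀ ℕ, α = β + Finsupp.single i 1 :=
      ⟨α - Finsupp.single i 1, by
        rw [tsub_add_cancel_of_le]
        rw [Finsupp.single_le_iff]; omega⟩
    have hβ : β.degree = d := by
      simpa using hα
    obtain ⟨c, hc, h⟩ := ih β hβ
    have hb : ((β i : K) + 1) ≠ 0 := by exact_mod_cast Nat.succ_ne_zero (β i)
    refine ⟨c * (β i + 1), mul_ne_zero hc hb, fun S => ?_⟩
    have h1 : monomial (β + Finsupp.single i 1) (1 : K) = X i * monomial β 1 := by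
      rw [X, monomial_mul, one_mul, add_comm]
    have h2 : aeval (lin K a b) (X i * monomial β (1 : K)) =
        lin K a b i * aeval (lin K a b) (monomial β (1 : K)) := by
      rw [map_mul, aeval_X]
    rw [h1, h2, coeff_lin_mul]
    have h3 := coeff_pderiv (i := i) (edgeProd K a b S) β
    rw [pderiv_edgeProd, coeff_sum] at h3
    simp only [coeff_C_mul] at h3
    simp only [h]
    calc _ = c * ∑ e ∈ S, inc K a b e i * coeff β (edgeProd K a b (S.erase e)) := by
          rw [Finset.mul_sum]
          exact Finset.sum_congr rfl (fun _ _ => by ring)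
      _ = _ := by rw [h3]; ring

/-! ### Filtration -/

/-- polynomials of degree `< j` -/
def Vlt (K : Type*) [Field K] (n j : ℕ) : Submodule K (MvPolynomial (Fin n) K) :=
  Submodule.span K (Set.image (fun α => monomial α (1 : K)) {α : Fin n →₀ ℕ | α.degree < j})

instance Vlt_fin (K : Type*) [Field K] (n j : ℕ) : FiniteDimensional K (Vlt K n j) :=
  FiniteDimensional.span_of_finite K ((Finsupp.finite_of_degree_lt j).image _)

/-- evaluation at the generators -/
def phi (K : Type*) [Field K] {n : ℕ} {E : Type*} [Fintype E]
    (a b : E → Fin n) (q : K) : MvPolynomial (Fin n) K →ₗ[K] PhiAlg K E (fun _ => q) :=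
  (aeval (XX K a b (fun _ => q)) : MvPolynomial (Fin n) K →ₐ[K] PhiAlg K E (fun _ => q)).toLinearMap

lemma phi_eq {K : Type*} [Field K] {n : ℕ} {E : Type*} [Fintype E]
    (a b : E → Fin n) (q : K) (f : MvPolynomial (Fin n) K) :
    phi K a b q f = Ideal.Quotient.mk (relIdeal K E (fun _ => q)) (aeval (lin K a b) f) := by
  have h : (aeval (XX K a b (fun _ => q)) : MvPolynomial (Fin n) K →ₐ[K] PhiAlg K E (fun _ => q)) =
      (Ideal.Quotient.mkₐ K (relIdeal K E (fun _ => q))).comp (aeval (lin K a b)) := by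
    apply MvPolynomial.algHom_ext
    intro i
    simp only [aeval_X, AlgHom.comp_apply]
    rfl
  exact DFunLike.congr_fun h f

/-- the filtration pieces -/
def Fl (K : Type*) [Field K] {n : ℕ} {E : Type*} [Fintype E]
    (a b : E → Fin n) (q : K) (j : ℕ) : Submodule K (PhiAlg K E (fun _ => q)) :=
  (Vlt K n j).map (phi K a b q)

instance Fl_fin (K : Type*) [Field K] {n : ℕ} {E : Type*} [Fintype E]
    (a b : E → Fin n) (q : K) (j : ℕ) : FiniteDimensional K (Fl K a b q j) := by
  unfold Fl; infer_instance

lemma Fk_eq {K : Type*} [Field K] {n : ℕ} {E : Type*} [Fintype E]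
    (a b : E → Fin n) (q : K) (k : ℕ) : Fk K a b (fun _ => q) k = Fl K a b q (k + 1) := by
  rw [Fk, Fl, Vlt, Submodule.map_span]
  congr 1
  have hm : ∀ α : Fin n →₀ ℕ, phi K a b q (monomial α 1) =
      ∏ i, (XX K a b (fun _ => q) i) ^ (α i) := by
    intro α
    simp only [phi, AlgHom.toLinearMap_apply, aeval_monomial, map_one, one_mul]
    exact Finsupp.prod_fintype _ _ (fun i => pow_zero _)
  ext y
  constructor
  · rintro ⟨α, hα, rfl⟩
    refine ⟨_, ⟨Finsupp.equivFunOnFinite.symm α, ?_, rfl⟩, ?_⟩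
    · simp only [Set.mem_ofPred_eq, Finsupp.degree_eq_sum]
      simpa [Nat.lt_succ_iff] using hα
    · rw [hm]; simp
  · rintro ⟨_, ⟨α, hα, rfl⟩, rfl⟩
    refine ⟨α, ?_, hm α⟩
    simp only [Set.mem_ofPred_eq, Finsupp.degree_eq_sum] at hα
    omega

lemma Vlt_mono {K : Type*} [Field K] {n i j : ℕ} (h : i ≤ j) : Vlt K n i ≤ Vlt K n j := by
  apply Submodule.span_mono
  apply Set.image_mono
  intro α hα
  exact lt_of_lt_of_le hα h

lemma Vlt_succ {K : Type*} [Field K] {n j : ℕ} :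
    Vlt K n (j + 1) ≤ Vlt K n j ⊔ homogeneousSubmodule (Fin n) K j := by
  rw [Vlt, Submodule.span_le]
  rintro _ ⟨α, hα, rfl⟩
  rcases Nat.lt_succ_iff_lt_or_eq.1 hα with h | h
  · exact Submodule.mem_sup_left (Submodule.subset_span ⟨α, h, rfl⟩)
  · exact Submodule.mem_sup_right (isHomogeneous_monomial _ h)

/-- top coefficients -/
def topC {K : Type*} [Field K] {E : Type*} [DecidableEq E] (q : K) (d : ℕ) :
    PhiAlg K E (fun _ => q) →ₗ[K] ({S : Finset E // S.card = d} → K) :=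
  LinearMap.pi (fun S => Lbar q S.1)

lemma topC_phi {K : Type*} [Field K] {n : ℕ} {E : Type*} [Fintype E] [DecidableEq E]
    (a b : E → Fin n) (q : K) (d : ℕ) (f : MvPolynomial (Fin n) K) (hf : f ∈ Vlt K n (d + 1))
    (S : {S : Finset E // S.card = d}) :
    topC q d (phi K a b q f) S = coeff (indS S.1) (aeval (lin K a b) f) := by
  simp only [topC, LinearMap.pi_apply, phi_eq, Lbar_mk]
  induction hf using Submodule.span_induction with
  | mem x hx =>
    obtain ⟨α, hα, rfl⟩ := hx
    refine Lq_hom q S.1 _ (1 * α.degree)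
      ((isHomogeneous_monomial _ rfl).aeval _ (fun i => lin_hom a b i)) ?_
    have : α.degree < d + 1 := hα
    have := S.2
    omega
  | zero => simp
  | add x y _ _ hx hy => simp only [map_add, coeff_add, hx, hy]
  | smul c x _ hx => simp only [map_smul, coeff_smul, hx]

lemma topC_low {K : Type*} [Field K] {n : ℕ} {E : Type*} [Fintype E] [DecidableEq E]
    (a b : E → Fin n) (q : K) (d : ℕ) (f : MvPolynomial (Fin n) K) (hf : f ∈ Vlt K n d) :
    topC q d (phi K a b q f) = 0 := by
  ext S
  rw [topC_phi a b q d f (Vlt_mono (Nat.le_succ d) hf)]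
  induction hf using Submodule.span_induction with
  | mem x hx =>
    obtain ⟨α, hα, rfl⟩ := hx
    have h1 : (aeval (lin K a b) (monomial α (1 : K))).IsHomogeneous (1 * α.degree) :=
      (isHomogeneous_monomial _ rfl).aeval _ (fun i => lin_hom a b i)
    apply h1.coeff_eq_zero
    rw [indS_degree, S.2]
    have : α.degree < d := hα
    omega
  | zero => simp
  | add x y _ _ hx hy => simp only [map_add, coeff_add, hx, hy]; simp
  | smul c x _ hx => simp only [map_smul, coeff_smul, hx]; simp

lemma map_topC {K : Type*} [Field K] {n : ℕ} {E : Type*} [Fintype E] [DecidableEq E]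
    (a b : E → Fin n) (q : K) (d : ℕ) :
    (Fl K a b q (d + 1)).map (topC q d) = (Fl K a b 0 (d + 1)).map (topC 0 d) := by
  simp only [Fl, ← Submodule.map_comp]
  ext y
  constructor
  · rintro ⟨f, hf, rfl⟩
    refine ⟨f, hf, ?_⟩
    ext S
    simp only [LinearMap.comp_apply]
    rw [topC_phi a b q d f hf, topC_phi a b 0 d f hf]
  · rintro ⟨f, hf, rfl⟩
    refine ⟨f, hf, ?_⟩
    ext S
    simp only [LinearMap.comp_apply]
    rw [topC_phi a b q d f hf, topC_phi a b 0 d f hf]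

lemma finrank_le_map_add {K M N : Type*} [Field K] [AddCommGroup M] [Module K M]
    [AddCommGroup N] [Module K N] (f : M →ₗ[K] N) (A B : Submodule K M) [FiniteDimensional K A]
    [FiniteDimensional K B] (hf : ∀ x ∈ A, f x = 0 → x ∈ B) :
    Module.finrank K A ≤ Module.finrank K (A.map f) + Module.finrank K B := by
  have h := (f.domRestrict A).finrank_range_add_finrank_ker
  rw [LinearMap.range_domRestrict] at h
  rw [← h]
  gcongr
  have h2 : (LinearMap.ker (f.domRestrict A)).map A.subtype ≤ B := by
    rintro _ ⟨x, hx, rfl⟩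
    exact hf _ x.2 hx
  rw [← Submodule.finrank_map_subtype_eq A]
  exact Submodule.finrank_mono h2

lemma Fl_step {K : Type*} [Field K] {n : ℕ} {E : Type*} [Fintype E] [DecidableEq E]
    (a b : E → Fin n) (q : K) (d : ℕ) :
    Module.finrank K (Fl K a b 0 (d + 1)) + Module.finrank K (Fl K a b q d) ≤
      Module.finrank K (Fl K a b q (d + 1)) + Module.finrank K (Fl K a b 0 d) := by
  have h1 := finrank_map_add_le (topC q d) (Fl K a b q (d + 1)) (Fl K a b q d)
    (Submodule.map_mono (Vlt_mono (Nat.le_succ d)))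
    (by rintro _ ⟨f, hf, rfl⟩; exact topC_low a b q d f hf)
  have h2 := finrank_le_map_add (topC 0 d) (Fl K a b 0 (d + 1)) (Fl K a b 0 d) (by
    rintro _ ⟨f, hf, rfl⟩ h0
    obtain ⟨g, hg, t, ht, rfl⟩ := Submodule.mem_sup.1 (Vlt_succ hf)
    rw [map_add, map_add, topC_low a b 0 d g hg, zero_add] at h0
    have ht' : t ∈ Vlt K n (d + 1) := by
      have := Submodule.sub_mem _ hf (Vlt_mono (Nat.le_succ d) hg)
      simpa using this
    have hom : (aeval (lin K a b) t).IsHomogeneous (1 * d) :=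
      IsHomogeneous.aeval ht _ (fun i => lin_hom a b i)
    have : phi K a b 0 t = 0 := by
      rw [phi_eq, Ideal.Quotient.eq_zero_iff_mem]
      refine hom_mem_rel _ _ hom ?_
      intro S hS
      rw [one_mul] at hS
      have := congrFun h0 ⟨S, hS⟩
      rwa [topC_phi a b 0 d t ht'] at this
    rw [map_add, this, add_zero]
    exact ⟨g, hg, rfl⟩)
  rw [map_topC] at h1
  omega

/-! ### Upper bound for the deformed algebra -/

lemma mem_rel_of_eval {K : Type*} [Field K] {E : Type*} [Fintype E] [DecidableEq E]
    (q : K) (hq : q ≠ 0) (p : MvPolynomial E K)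
    (h : ∀ S : Finset E, eval (fun e => if e ∈ S then q else 0) p = 0) :
    p ∈ relIdeal K E (fun _ => q) := by
  classical
  obtain ⟨g, -, hg⟩ := combinatorial_nullstellensatz_exists_linearCombination
    (fun _ : E => ({0, q} : Finset K)) (fun _ => ⟨0, by simp⟩) p (by
      intro x hx
      have := h (Finset.univ.filter (fun e => x e = q))
      refine Eq.trans (congrArg (fun y => eval y p) (funext fun e => ?_)) this
      have := hx e
      simp only [Finset.mem_insert, Finset.mem_singleton] at this
      simp only [Finset.mem_filter, Finset.mem_univ, true_and]
      split_ifs with h2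
      · exact h2
      · exact this.resolve_right h2)
  rw [hg, Finsupp.linearCombination_apply]
  apply Ideal.sum_mem
  intro e _
  change g e * _ ∈ _
  apply Ideal.mul_mem_left
  rw [Finset.prod_pair hq.symm]
  apply Ideal.subset_span
  refine ⟨e, ?_⟩
  simp only [C_0]
  ring

lemma eval_lin {K : Type*} [Field K] {n : ℕ} {E : Type*} [Fintype E] [DecidableEq E]
    (a b : E → Fin n) (q : K) (S : Finset E) (i : Fin n) :
    eval (fun e => if e ∈ S then q else 0) (lin K a b i) = q * (scoreV a b S i : ℤ) := by
  rw [lin_eq, map_sum]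
  simp only [map_mul, eval_C, eval_X, scoreV, Finset.sum_apply, Pi.sub_apply]
  push_cast
  rw [Finset.mul_sum]
  rw [← Finset.sum_subset (Finset.subset_univ S)]
  · apply Finset.sum_congr rfl
    intro e he
    rw [if_pos he, mul_comm]
    congr 1
    simp only [inc, Pi.single_apply, eq_comm (a := i)]
    split_ifs <;> simp
  · intro e _ he
    rw [if_neg he, mul_zero]

lemma eval_aeval_lin {K : Type*} [Field K] {n : ℕ} {E : Type*} [Fintype E] [DecidableEq E]
    (a b : E → Fin n) (q : K) (S : Finset E) (f : MvPolynomial (Fin n) K) :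
    eval (fun e => if e ∈ S then q else 0) (aeval (lin K a b) f) =
      eval (fun i => q * (scoreV a b S i : ℤ)) f := by
  induction f using MvPolynomial.induction_on with
  | C c => simp
  | add f g hf hg => simp only [map_add, hf, hg]
  | mul_X f i hf => simp only [map_mul, hf, aeval_X, eval_lin, eval_X]

lemma Fl_upper {K : Type*} [Field K] {n : ℕ} {E : Type*} [Fintype E] [DecidableEq E]
    (a b : E → Fin n) (q : K) (hq : q ≠ 0) (N : ℕ) :
    Module.finrank K (Fl K a b q N) ≤ (scoreSet a b (Finset.univ : Finset E)).card := by
  -- evaluation on the score set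
  set D := scoreSet a b (Finset.univ : Finset E) with hD
  let ev : MvPolynomial (Fin n) K →ₗ[K] (D → K) :=
    LinearMap.pi (fun d => (aeval (fun i => q * ((d.1 i : ℤ) : K)) :
      MvPolynomial (Fin n) K →ₐ[K] K).toLinearMap)
  have hker : ∀ f, ev f = 0 → phi K a b q f = 0 := by
    intro f hf
    rw [phi_eq, Ideal.Quotient.eq_zero_iff_mem]
    apply mem_rel_of_eval q hq
    intro S
    rw [eval_aeval_lin]
    have := congrFun hf ⟨scoreV a b S, Finset.mem_image_of_mem _ (by simp)⟩
    simpa [ev, MvPolynomial.aeval_eq_eval] using this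
  have h1 := ((phi K a b q).domRestrict (Vlt K n N)).finrank_range_add_finrank_ker
  have h2 := (ev.domRestrict (Vlt K n N)).finrank_range_add_finrank_ker
  have h3 : LinearMap.ker (ev.domRestrict (Vlt K n N)) ≤
      LinearMap.ker ((phi K a b q).domRestrict (Vlt K n N)) := by
    intro x hx
    exact hker _ hx
  have h4 := Submodule.finrank_mono h3
  have h5 := Submodule.finrank_le (LinearMap.range (ev.domRestrict (Vlt K n N)))
  rw [Module.finrank_fintype_fun_eq_card, Fintype.card_coe] at h5
  rw [LinearMap.range_domRestrict] at h1
  rw [Fl]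
  omega

/-! ### Lower bound for the undeformed algebra -/

lemma Fl_lower {K : Type*} [Field K] [CharZero K] {n : ℕ} {E : Type*} [Fintype E] [DecidableEq E]
    (a b : E → Fin n) (N : ℕ) (hN : Fintype.card E < N) :
    (scoreSet a b (Finset.univ : Finset E)).card ≤ Module.finrank K (Fl K a b (0 : K) N) := by
  refine (card_scoreSet_le (K := K) Finset.univ a b).trans ?_
  let Γ : (Finset E → K) →ₗ[K] MvPolynomial (Fin n) K :=
    Fintype.linearCombination K (edgeProd K a b)
  let Λ : (Finset E → K) →ₗ[K] Module.Dual K (Fl K a b (0 : K) N) :=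
    Fintype.linearCombination K (fun S => (Lbar (0 : K) S).domRestrict (Fl K a b (0 : K) N))
  have hΓ : edgeSpan K a b (Finset.univ : Finset E) = LinearMap.range Γ := by
    rw [Fintype.range_linearCombination, edgeSpan]
    congr 1
    ext x
    simp
  have hker : LinearMap.ker Λ ≤ LinearMap.ker Γ := by
    intro c hc
    rw [LinearMap.mem_ker] at hc ⊢
    ext α
    rw [coeff_zero]
    have hΓc : coeff α (Γ c) = ∑ S, c S * coeff α (edgeProd K a b S) := by
      simp [Γ, Fintype.linearCombination_apply, coeff_sum]
    by_cases hα : α.degree < N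
    · obtain ⟨r, hr, h⟩ := coeff_duality (K := K) a b _ α rfl
      have hm : phi K a b (0 : K) (monomial α 1) ∈ Fl K a b (0 : K) N :=
        ⟨_, Submodule.subset_span ⟨α, hα, rfl⟩, rfl⟩
      have h1 := DFunLike.congr_fun hc ⟨_, hm⟩
      have h2 : ∑ S, c S * coeff (indS S) (aeval (lin K a b) (monomial α (1 : K))) = 0 := by
        simpa [Λ, Fintype.linearCombination_apply, LinearMap.sum_apply, phi_eq, Lbar_mk,
          Lq_zero] using h1
      simp only [h] at h2
      have h3 : r * coeff α (Γ c) = 0 := by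
        rw [hΓc, Finset.mul_sum, ← h2]
        exact Finset.sum_congr rfl (fun _ _ => by ring)
      exact (mul_eq_zero.1 h3).resolve_left hr
    · rw [hΓc]
      apply Finset.sum_eq_zero
      intro S _
      have hom : (edgeProd K a b S).IsHomogeneous (∑ e ∈ S, 1) :=
        IsHomogeneous.prod _ _ _ (fun e _ => (isHomogeneous_X _ _).sub (isHomogeneous_X _ _))
      rw [hom.coeff_eq_zero, mul_zero]
      have := Finset.card_le_univ S
      simp only [Finset.sum_const, smul_eq_mul, mul_one]
      omega
  have h1 := Γ.finrank_range_add_finrank_ker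
  have h2 := Λ.finrank_range_add_finrank_ker
  have h3 := Submodule.finrank_mono hker
  have h4 := Submodule.finrank_le (LinearMap.range Λ)
  rw [Subspace.dual_finrank_eq] at h4
  rw [hΓ]
  omega

lemma Fl_eq {K : Type*} [Field K] [CharZero K] {n : ℕ} {E : Type*} [Fintype E] [DecidableEq E]
    (a b : E → Fin n) (q : K) (hq : q ≠ 0) (j : ℕ) :
    Module.finrank K (Fl K a b q j) = Module.finrank K (Fl K a b 0 j) := by
  have hmono : ∀ i m : ℕ, Module.finrank K (Fl K a b 0 (i + m)) + Module.finrank K (Fl K a b q i) ≤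
      Module.finrank K (Fl K a b q (i + m)) + Module.finrank K (Fl K a b 0 i) := by
    intro i m
    induction m with
    | zero => exact (add_comm _ _).le
    | succ m ih =>
      have := Fl_step a b q (i + m)
      rw [← add_assoc]
      omega
  have hzero : ∀ r : K, Module.finrank K (Fl K a b r 0) = 0 := by
    intro r
    have : Fl K a b r 0 = ⊥ := by simp [Fl, Vlt]
    rw [this]; simp
  have h1 := hmono 0 j
  rw [hzero, hzero, zero_add] at h1
  have h2 := hmono j (Fintype.card E + 1)
  have h3 := Fl_upper a b q hq (j + (Fintype.card E + 1))
  have h4 := Fl_lower (K := K) a b (j + (Fintype.card E + 1)) (by omega)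
  omega

/-- The Hilbert polynomial of the Hecke deformation `Ψ_{G,q}` coincides with
that of the undeformed algebra `C_G = Ψ_{G,0}`. -/
theorem hecke_hilbert_eq
    {K : Type*} [Field K] [CharZero K] {n : ℕ} {E : Type*} [Fintype E] [DecidableEq E]
    (a b : E → Fin n) (hab : ∀ e, a e < b e) (q : K) (k : ℕ) :
    Module.finrank K (Fk K a b (fun _ => q) k) =
      Module.finrank K (Fk K a b (fun _ => (0 : K)) k) := by
  rw [Fk_eq, Fk_eq]
  by_cases hq : q = 0
  · subst hq; rfl
  · exact Fl_eq a b q hq (k + 1)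

end
end

section
/- Let G be a loopless graph and let q ∈ K, with Hecke parameters q_e = q for all edges e. Then all defining relations among X_1, …, X_n are generated by cut relations: the kernel of the K-algebra homomorphism K[x_1, …, x_n] → Φ_{G,q} sending x_i ↦ X_i equals the ideal generated by the elements ∏_{k = −d⃗_I}^{d⃖_I} ( Σ_{i ∈ I} x_i − q·k ), where I ranges over all nonempty subsets of Fin n. -/
open MvPolynomial

set_option synthInstance.maxHeartbeats 1000000
set_option maxHeartbeats 1000000

noncomputable section

/-- The edges of the cut oriented out of `I` (small endpoint in `I`). -/
def cutOut {n : ℕ} {E : Type*} [Fintype E] (a b : E → Fin n) (I : Finset (Fin n)) :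
    Finset E :=
  Finset.univ.filter fun e => a e ∈ I ∧ b e ∉ I

/-- The edges of the cut oriented into `I` (large endpoint in `I`). -/
def cutIn {n : ℕ} {E : Type*} [Fintype E] (a b : E → Fin n) (I : Finset (Fin n)) :
    Finset E :=
  Finset.univ.filter fun e => b e ∈ I ∧ a e ∉ I

section Helpers

open Finset

variable {K : Type*} [Field K] {V : Type*} [DecidableEq V]

/-- The substitution `x_i ↦ x_i + ε`, `x_j ↦ x_j - ε` with `ε ^ 2 = q ε`. -/
def dlHom (q : K) (i j : V) :
    MvPolynomial V K →ₐ[K] QuadraticAlgebra (MvPolynomial V K) 0 (C q) :=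
  aeval fun v => ⟨X v, (if v = i then 1 else 0) - (if v = j then 1 else 0)⟩

/-- The twisted derivation. -/
def Dl (q : K) (i j : V) (p : MvPolynomial V K) : MvPolynomial V K := (dlHom q i j p).im

lemma dlHom_re (q : K) (i j : V) (p : MvPolynomial V K) : (dlHom q i j p).re = p := by
  induction p using MvPolynomial.induction_on with
  | C r => simp only [dlHom, aeval_C]; rfl
  | add p r hp hr => simp [hp, hr]
  | mul_X p v hp => simp [hp]; simp [dlHom]

lemma Dl_add (q : K) (i j : V) (p r : MvPolynomial V K) :
    Dl q i j (p + r) = Dl q i j p + Dl q i j r := by simp [Dl]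

lemma Dl_sub (q : K) (i j : V) (p r : MvPolynomial V K) :
    Dl q i j (p - r) = Dl q i j p - Dl q i j r := by simp [Dl]

lemma Dl_neg (q : K) (i j : V) (p : MvPolynomial V K) :
    Dl q i j (-p) = - Dl q i j p := by simp [Dl]

lemma Dl_zero (q : K) (i j : V) : Dl q i j 0 = 0 := by simp [Dl]

lemma Dl_sum (q : K) (i j : V) {ι : Type*} (s : Finset ι) (f : ι → MvPolynomial V K) :
    Dl q i j (∑ t ∈ s, f t) = ∑ t ∈ s, Dl q i j (f t) := by
  classical
  induction s using Finset.induction_on with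
  | empty => simp [Dl_zero]
  | insert a s ha ih => simp [Finset.sum_insert ha, Dl_add, ih]

lemma Dl_C (q : K) (i j : V) (r : K) : Dl q i j (C r) = 0 := by
  simp only [Dl, dlHom, aeval_C]; rfl

lemma Dl_X (q : K) (i j v : V) :
    Dl q i j (X v) = (if v = i then 1 else 0) - (if v = j then 1 else 0) := by
  simp [Dl, dlHom]

lemma Dl_mul (q : K) (i j : V) (p r : MvPolynomial V K) :
    Dl q i j (p * r) = Dl q i j p * (r + C q * Dl q i j r) + p * Dl q i j r := by
  simp only [Dl, map_mul, QuadraticAlgebra.im_mul, dlHom_re]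
  ring

lemma Dl_self (q : K) (i : V) (p : MvPolynomial V K) : Dl q i i p = 0 := by
  induction p using MvPolynomial.induction_on with
  | C r => exact Dl_C ..
  | add p r hp hr => simp [Dl_add, hp, hr]
  | mul_X p v hp => simp [Dl_mul, hp, Dl_X]

lemma Dl_sumX (q : K) (i j : V) (I : Finset V) :
    Dl q i j (∑ v ∈ I, X v) = (if i ∈ I then 1 else 0) - (if j ∈ I then 1 else 0) := by
  simp [Dl_sum, Dl_X, Finset.sum_sub_distrib]

/-- Falling factorial with step `q`. -/
def fall (q : K) (z : MvPolynomial V K) (k : ℕ) : MvPolynomial V K :=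
  ∏ t ∈ range k, (z - C (q * (t : K)))

lemma fall_zero (q : K) (z : MvPolynomial V K) : fall q z 0 = 1 := by simp [fall]

lemma fall_succ (q : K) (z : MvPolynomial V K) (k : ℕ) :
    fall q z (k + 1) = fall q z k * (z - C (q * (k : K))) := by
  simp [fall, Finset.prod_range_succ]

lemma fall_shift (q : K) (z : MvPolynomial V K) (k : ℕ) :
    (z + C q) * fall q z k = fall q (z + C q) (k + 1) := by
  simp only [fall, Finset.prod_range_succ']
  rw [mul_comm]
  congr 1
  · refine Finset.prod_congr rfl fun t _ => ?_
    simp only [map_mul, map_add, Nat.cast_succ, map_one]; ring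
  · simp

lemma Dl_fall (q : K) (i j : V) (z : MvPolynomial V K) (hz : Dl q i j z = 1) (k : ℕ) :
    Dl q i j (fall q z (k + 1)) = (k + 1 : MvPolynomial V K) * fall q z k := by
  induction k with
  | zero => simp [fall_succ, fall_zero, Dl_sub, Dl_mul, hz, Dl_C]
  | succ k ih =>
    rw [fall_succ, Dl_mul, ih, Dl_sub, hz, Dl_C]
    rw [fall_succ q z k]
    simp only [map_mul, Nat.cast_succ, map_add, map_one]; ring

lemma Dl_fall' (q : K) (i j : V) (z : MvPolynomial V K) (hz : Dl q i j z = 0) (k : ℕ) :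
    Dl q i j (fall q z k) = 0 := by
  induction k with
  | zero => rw [fall_zero]; simpa using Dl_C q i j 1
  | succ k ih => rw [fall_succ, Dl_mul, ih, Dl_sub, hz, Dl_C]; simp

/-- The recursive description of the kernel. -/
def NN (q : K) : List (V × V) → MvPolynomial V K → Prop
  | [], p => constantCoeff p = 0
  | e :: G, p => NN q G p ∧ NN q G (Dl q e.1 e.2 p)

/-- number of edges out of `I` -/
def cO (I : Finset V) (G : List (V × V)) : ℕ := G.countP fun e => e.1 ∈ I ∧ e.2 ∉ I

/-- number of edges into `I` -/
def cI (I : Finset V) (G : List (V × V)) : ℕ := G.countP fun e => e.2 ∈ I ∧ e.1 ∉ I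

/-- cut relation -/
def gen (q : K) (G : List (V × V)) (I : Finset V) : MvPolynomial V K :=
  fall q ((∑ v ∈ I, X v) + C (q * (cI I G : K))) (cI I G + cO I G + 1)

/-- The ideal of cut relations. -/
def JJ (q : K) (G : List (V × V)) : Ideal (MvPolynomial V K) :=
  Ideal.span (Set.range (gen q G))

lemma fall_flip (q : K) (z : MvPolynomial V K) (m n : ℕ) :
    fall q (z + C (q * (m : K))) (m + n + 1) =
      (-1) ^ (m + n + 1) * fall q (-z + C (q * (n : K))) (m + n + 1) := by
  unfold fall
  rw [← Finset.prod_range_reflect]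
  rw [show (-1 : MvPolynomial V K) ^ (m + n + 1) = ∏ t ∈ range (m + n + 1), (-1) by simp,
    ← Finset.prod_mul_distrib]
  refine Finset.prod_congr rfl fun t ht => ?_
  have : t ≤ m + n := by simp at ht; omega
  simp only [Nat.add_sub_cancel, Nat.cast_sub this, map_mul, map_sub, map_add, Nat.cast_add]
  ring

lemma NN_sub (q : K) (G : List (V × V)) (p r : MvPolynomial V K) (hp : NN q G p)
    (hr : NN q G r) : NN q G (p - r) := by
  induction G generalizing p r with
  | nil => simp_all [NN]
  | cons e G ih => exact ⟨ih _ _ hp.1 hr.1, by rw [Dl_sub]; exact ih _ _ hp.2 hr.2⟩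

/-- Case analysis for a new edge. -/
lemma gen_cases (q : K) (i j : V) (G : List (V × V)) (I : Finset V) :
    (gen q ((i, j) :: G) I = gen q G I ∧ Dl q i j (gen q ((i, j) :: G) I) = 0) ∨
    ∃ (z : MvPolynomial V K) (u : (MvPolynomial V K)) (w : (MvPolynomial V K)) (N : ℕ),
      u * u = 1 ∧ w * w = 1 ∧ Dl q i j u = 0 ∧
      Dl q i j z = 1 ∧ gen q ((i, j) :: G) I = u * fall q z (N + 1) ∧
      gen q G I = w * fall q z N ∧
      ((i ∈ I ∧ j ∉ I ∧ ∃ r : K, z = (∑ v ∈ I, X v) + C r) ∨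
       (i ∉ I ∧ j ∈ I ∧ ∃ r : K, z = -(∑ v ∈ I, X v) + C r)) := by
  by_cases hi : i ∈ I <;> by_cases hj : j ∈ I
  · left
    constructor
    · simp [gen, cI, cO, List.countP_cons, hi, hj]
    · apply Dl_fall'; rw [Dl_add, Dl_C]; simp [Dl_sumX, hi, hj]
  · right
    refine ⟨(∑ v ∈ I, X v) + C (q * (cI I G : K)), 1, 1, cI I G + cO I G + 1, by simp, by simp, ?_, ?_, ?_,
      ?_, Or.inl ⟨hi, hj, _, rfl⟩⟩
    · simpa using Dl_C q i j 1
    · rw [Dl_add, Dl_C]; simp [Dl_sumX, hi, hj]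
    · simp [gen, cI, cO, List.countP_cons, hi, hj]; rfl
    · simp [gen]
  · right
    refine ⟨-(∑ v ∈ I, X v) + C (q * (cO I G : K)), (-1) ^ (cI I G + 1 + cO I G + 1), (-1) ^ (cI I G + cO I G + 1), cI I G + cO I G + 1, ?_, ?_, ?_, ?_, ?_,
      ?_, Or.inr ⟨hi, hj, _, rfl⟩⟩
    · rw [← mul_pow]; simp
    · rw [← mul_pow]; simp
    · have := Dl_C q i j ((-1) ^ (cI I G + 1 + cO I G + 1)); simpa using this
    · rw [Dl_add, Dl_C, Dl_neg]; simp [Dl_sumX, hi, hj]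
    · have h1 : cI I ((i, j) :: G) = cI I G + 1 := by simp [cI, List.countP_cons, hi, hj]
      have h2 : cO I ((i, j) :: G) = cO I G := by simp [cO, List.countP_cons, hi, hj]
      rw [gen, h1, h2, fall_flip]
      congr 2; ring
    · rw [gen, fall_flip]
  · left
    constructor
    · simp [gen, cI, cO, List.countP_cons, hi, hj]
    · apply Dl_fall'; rw [Dl_add, Dl_C]; simp [Dl_sumX, hi, hj]

lemma gen_mem (q : K) (G : List (V × V)) (I : Finset V) : gen q G I ∈ JJ q G :=
  Ideal.subset_span ⟨I, rfl⟩

lemma fall_mem_of (q : K) (G : List (V × V)) (I : Finset V) (w f : MvPolynomial V K)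
    (hw : w * w = 1) (h : gen q G I = w * f) : f ∈ JJ q G := by
  have : f = w * gen q G I := by rw [h, ← mul_assoc, hw, one_mul]
  rw [this]; exact Ideal.mul_mem_left _ _ (gen_mem q G I)

lemma JJ_cons (q : K) (i j : V) (G : List (V × V)) (p : MvPolynomial V K)
    (hp : p ∈ JJ q ((i, j) :: G)) : p ∈ JJ q G ∧ Dl q i j p ∈ JJ q G := by
  unfold JJ at hp
  induction hp using Submodule.span_induction with
  | mem x hx =>
    obtain ⟨I, rfl⟩ := hx
    rcases gen_cases q i j G I with ⟨h1, h2⟩ | ⟨z, u, w, N, hu, hw, hDu, hz, h1, h2, -⟩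
    · rw [h2, h1]; exact ⟨gen_mem _ _ _, Ideal.zero_mem _⟩
    · have hf := fall_mem_of q G I w _ hw h2
      rw [h1, Dl_mul, hDu, Dl_fall _ _ _ _ hz, fall_succ]
      constructor
      · exact Ideal.mul_mem_left _ _ (Ideal.mul_mem_right _ _ hf)
      · rw [zero_mul, zero_add]
        exact Ideal.mul_mem_left _ _ (Ideal.mul_mem_left _ _ hf)
  | zero => simp [Dl_zero]
  | add x y _ _ hx hy =>
    rw [Dl_add]; exact ⟨add_mem hx.1 hy.1, add_mem hx.2 hy.2⟩
  | smul r x _ hx =>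
    rw [smul_eq_mul, mul_comm, Dl_mul]
    exact ⟨Ideal.mul_mem_right _ _ hx.1, add_mem (Ideal.mul_mem_right _ _ hx.2)
      (Ideal.mul_mem_right _ _ hx.1)⟩

lemma JJ_le_NN (q : K) (G : List (V × V)) (p : MvPolynomial V K) (hp : p ∈ JJ q G) :
    NN q G p := by
  induction G generalizing p with
  | nil =>
    have : JJ q ([] : List (V × V)) ≤ RingHom.ker (constantCoeff : MvPolynomial V K →+* K) := by
      refine Ideal.span_le.2 ?_
      rintro _ ⟨I, rfl⟩
      simp [gen, cI, cO, fall, RingHom.mem_ker]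
    exact this hp
  | cons e G ih =>
    obtain ⟨h1, h2⟩ := JJ_cons q e.1 e.2 G p hp
    exact ⟨ih _ h1, ih _ h2⟩

lemma C_mem (S : Subalgebra K (MvPolynomial V K)) (r : K) : C r ∈ S := S.algebraMap_mem r

/-- Every polynomial is a combination of falling factorials with coefficients in `S`. -/
lemma span_fall (q : K) (S : Subalgebra K (MvPolynomial V K)) (z : MvPolynomial V K)
    (hS : ∀ v, ∃ c ∈ S, ∃ t : K, X v = c + C t * z) (p : MvPolynomial V K) :
    p ∈ Submodule.span K {m : MvPolynomial V K | ∃ c ∈ S, ∃ k, m = c * fall q z k} := by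
  induction p using MvPolynomial.induction_on with
  | C r =>
    refine Submodule.subset_span ⟨C r, S.algebraMap_mem r, 0, by simp [fall_zero]⟩
  | add p r hp hr => exact add_mem hp hr
  | mul_X p v hp =>
    obtain ⟨d, hd, t, hv⟩ := hS v
    rw [hv]
    induction hp using Submodule.span_induction with
    | mem x hx =>
      obtain ⟨c, hc, k, rfl⟩ := hx
      have : c * fall q z k * (d + C t * z) =
          (c * d + C (t * (q * (k : K))) * c) * fall q z k + (C t * c) * fall q z (k + 1) := by
        rw [fall_succ]; simp only [map_mul]; ring
      rw [this]
      exact add_mem (Submodule.subset_span ⟨_, add_mem (mul_mem hc hd)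
        (mul_mem (S.algebraMap_mem _) hc), _, rfl⟩)
        (Submodule.subset_span ⟨_, mul_mem (S.algebraMap_mem _) hc, _, rfl⟩)
    | zero => simp
    | add x y _ _ hx hy => rw [add_mul]; exact add_mem hx hy
    | smul r x _ hx => rw [smul_mul_assoc]; exact Submodule.smul_mem _ _ hx

lemma expand_fall (q : K) (S : Subalgebra K (MvPolynomial V K)) (z : MvPolynomial V K)
    (hS : ∀ v, ∃ c ∈ S, ∃ t : K, X v = c + C t * z) (p : MvPolynomial V K) :
    ∃ c : ℕ → MvPolynomial V K, (∀ k, c k ∈ S) ∧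
      ∃ n, ∀ m, n ≤ m → p = ∑ k ∈ range m, c k * fall q z k := by
  have hp := span_fall q S z hS p
  induction hp using Submodule.span_induction with
  | mem x hx =>
    obtain ⟨c, hc, k, rfl⟩ := hx
    refine ⟨fun l => if l = k then c else 0, fun l => ?_, k + 1, fun m hm => ?_⟩
    · dsimp only; split_ifs
      · exact hc
      · exact zero_mem _
    · rw [Finset.sum_eq_single k]
      · simp
      · intro b _ hb; simp [hb]
      · intro h; simp at h; omega
  | zero => exact ⟨fun _ => 0, fun _ => zero_mem _, 0, by simp⟩
  | add x y _ _ hx hy =>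
    obtain ⟨c, hc, n, h⟩ := hx
    obtain ⟨c', hc', n', h'⟩ := hy
    refine ⟨fun k => c k + c' k, fun k => add_mem (hc k) (hc' k), max n n', fun m hm => ?_⟩
    simp only [add_mul, Finset.sum_add_distrib]
    rw [← h m (le_trans (le_max_left _ _) hm), ← h' m (le_trans (le_max_right _ _) hm)]
  | smul r x _ hx =>
    obtain ⟨c, hc, n, h⟩ := hx
    refine ⟨fun k => r • c k, fun k => S.smul_mem (hc k) r, n, fun m hm => ?_⟩
    simp only [smul_mul_assoc, ← Finset.smul_sum]
    rw [← h m hm]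

lemma Dl_c_fall (q : K) (i j : V) (z c : MvPolynomial V K) (hz : Dl q i j z = 1)
    (hc : Dl q i j c = 0) (k : ℕ) :
    Dl q i j (c * fall q z (k + 1)) = ((k + 1 : ℕ) : MvPolynomial V K) * c * fall q z k := by
  rw [Dl_mul, hc, Dl_fall _ _ _ _ hz]; push_cast; ring

lemma Dl_expansion (q : K) (i j : V) (z : MvPolynomial V K) (hz : Dl q i j z = 1)
    (c : ℕ → MvPolynomial V K) (hc : ∀ k, Dl q i j (c k) = 0) (n : ℕ) :
    Dl q i j (∑ k ∈ range (n + 1), c k * fall q z k) =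
      ∑ k ∈ range n, ((k + 1 : ℕ) : MvPolynomial V K) * c (k + 1) * fall q z k := by
  rw [Finset.sum_range_succ', Dl_add, Dl_sum]
  simp only [Dl_c_fall q i j z _ hz (hc _), fall_zero, mul_one, hc, add_zero]

lemma Dl_natCast_mul (q : K) (i j : V) (m : ℕ) (c : MvPolynomial V K) (hc : Dl q i j c = 0) :
    Dl q i j ((m : MvPolynomial V K) * c) = 0 := by
  have : Dl q i j (m : MvPolynomial V K) = 0 := by simpa using Dl_C q i j (m : K)
  rw [Dl_mul, hc, this]; simp

variable [CharZero K]

lemma indep_fall (q : K) (i j : V) (z : MvPolynomial V K) (hz : Dl q i j z = 1)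
    (n : ℕ) (c : ℕ → MvPolynomial V K) (hc : ∀ k, Dl q i j (c k) = 0)
    (h : ∑ k ∈ range n, c k * fall q z k = 0) : ∀ k < n, c k = 0 := by
  induction n generalizing c with
  | zero => simp
  | succ n ih =>
    have h1 := Dl_expansion q i j z hz c hc n
    rw [h, Dl_zero] at h1
    have h2 := ih (fun k => ((k + 1 : ℕ) : MvPolynomial V K) * c (k + 1))
      (fun k => Dl_natCast_mul _ _ _ _ _ (hc _)) h1.symm
    have h3 : ∀ k < n, c (k + 1) = 0 := fun k hk => by
      have := h2 k hk
      rcases mul_eq_zero.1 this with h | h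
      · exact absurd h (Nat.cast_ne_zero.2 (Nat.succ_ne_zero k))
      · exact h
    have h4 : c 0 = 0 := by
      rw [Finset.sum_range_succ', Finset.sum_eq_zero] at h
      · simpa [fall_zero] using h
      · intro k hk; rw [h3 k (by simpa using hk), zero_mul]
    intro k hk
    cases k with
    | zero => exact h4
    | succ k => exact h3 k (by omega)

lemma ker_Dl (q : K) (i j : V) (S : Subalgebra K (MvPolynomial V K)) (z : MvPolynomial V K)
    (hS : ∀ v, ∃ c ∈ S, ∃ t : K, X v = c + C t * z) (hD : ∀ c ∈ S, Dl q i j c = 0)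
    (hz : Dl q i j z = 1) (p : MvPolynomial V K) (hp : Dl q i j p = 0) : p ∈ S := by
  obtain ⟨c, hc, n, h⟩ := expand_fall q S z hS p
  have h1 := h (n + 1) (Nat.le_succ n)
  rw [h1, Dl_expansion q i j z hz c fun k => hD _ (hc k)] at hp
  have h2 := indep_fall q i j z hz n (fun k => ((k + 1 : ℕ) : MvPolynomial V K) * c (k + 1))
      (fun k => Dl_natCast_mul _ _ _ _ _ (hD _ (hc _))) hp
  rw [h1, Finset.sum_range_succ', Finset.sum_eq_zero]
  · simpa [fall_zero] using hc 0
  · intro k hk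
    rcases mul_eq_zero.1 (h2 k (by simpa using hk)) with h | h
    · exact absurd h (Nat.cast_ne_zero.2 (Nat.succ_ne_zero k))
    · rw [h, zero_mul]

lemma natCast_eq_C (m : ℕ) : (m : MvPolynomial V K) = C (m : K) := by simp

lemma Dl_surj (q : K) (i j : V) (S : Subalgebra K (MvPolynomial V K)) (z : MvPolynomial V K)
    (hS : ∀ v, ∃ c ∈ S, ∃ t : K, X v = c + C t * z) (hD : ∀ c ∈ S, Dl q i j c = 0)
    (hz : Dl q i j z = 1) (p : MvPolynomial V K) : ∃ m, Dl q i j m = p := by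
  have hp := span_fall q S z hS p
  induction hp using Submodule.span_induction with
  | mem x hx =>
    obtain ⟨c, hc, k, rfl⟩ := hx
    refine ⟨C ((k + 1 : ℕ) : K)⁻¹ * c * fall q z (k + 1), ?_⟩
    rw [Dl_c_fall _ _ _ _ _ hz (hD _ (mul_mem (C_mem S _) hc)), natCast_eq_C,
      ← mul_assoc, ← map_mul, mul_inv_cancel₀ (Nat.cast_ne_zero.2 (Nat.succ_ne_zero k))]
    simp
  | zero => exact ⟨0, Dl_zero ..⟩
  | add x y _ _ hx hy =>
    obtain ⟨a, rfl⟩ := hx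
    obtain ⟨b, rfl⟩ := hy
    exact ⟨a + b, Dl_add ..⟩
  | smul r x _ hx =>
    obtain ⟨a, rfl⟩ := hx
    exact ⟨C r * a, by rw [Dl_mul, Dl_C, MvPolynomial.smul_eq_C_mul]; simp⟩

/-- The operator `(N+1) + (z + q) Δ` is surjective. -/
lemma op_surj (q : K) (i j : V) (S : Subalgebra K (MvPolynomial V K)) (z : MvPolynomial V K)
    (hS : ∀ v, ∃ c ∈ S, ∃ t : K, X v = c + C t * z) (hD : ∀ c ∈ S, Dl q i j c = 0)
    (hz : Dl q i j z = 1) (N : ℕ) (p : MvPolynomial V K) :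
    ∃ m, ((N : MvPolynomial V K) + 1) * m + (z + C q) * Dl q i j m = p := by
  have hp := span_fall q S z hS p
  induction hp using Submodule.span_induction with
  | mem x hx =>
    obtain ⟨c, hc, k, rfl⟩ := hx
    induction k with
    | zero =>
      refine ⟨C ((N + 1 : ℕ) : K)⁻¹ * (c * fall q z 0), ?_⟩
      rw [fall_zero, mul_one, hD _ (mul_mem (C_mem S _) hc), ← Nat.cast_succ,
        natCast_eq_C, ← mul_assoc, ← map_mul,
        mul_inv_cancel₀ (Nat.cast_ne_zero.2 (Nat.succ_ne_zero N))]
      simp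
    | succ k ih =>
      obtain ⟨m, hm⟩ := ih
      refine ⟨C ((N + 1 + (k + 1) : ℕ) : K)⁻¹ * (c * fall q z (k + 1)
        - C (q * ((k + 1 : ℕ) : K) * ((k + 1 : ℕ) : K)) * m), ?_⟩
      have hne : ((N + 1 + (k + 1) : ℕ) : K) ≠ 0 := Nat.cast_ne_zero.2 (by omega)
      rw [Dl_mul, Dl_C, Dl_sub, Dl_c_fall _ _ _ _ _ hz (hD _ hc), Dl_mul, Dl_C]
      have key : ((N : MvPolynomial V K) + 1) * (c * fall q z (k + 1)
          - C (q * ((k + 1 : ℕ) : K) * ((k + 1 : ℕ) : K)) * m)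
          + (z + C q) * (((k + 1 : ℕ) : MvPolynomial V K) * c * fall q z k -
            C (q * ((k + 1 : ℕ) : K) * ((k + 1 : ℕ) : K)) * Dl q i j m) =
          C ((N + 1 + (k + 1) : ℕ) : K) * (c * fall q z (k + 1)) := by
        rw [fall_succ]
        simp only [map_mul, map_natCast]
        push_cast
        linear_combination (-C q * ((k : MvPolynomial V K) + 1) * ((k : MvPolynomial V K) + 1)) * hm
      have : c * fall q z (k + 1) = C ((N + 1 + (k + 1) : ℕ) : K)⁻¹ *
          (C ((N + 1 + (k + 1) : ℕ) : K) * (c * fall q z (k + 1))) := by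
        rw [← mul_assoc, ← map_mul, inv_mul_cancel₀ hne]; simp
      refine Eq.trans ?_ this.symm
      rw [← key]
      ring
  | zero => exact ⟨0, by simp [Dl_zero]⟩
  | add x y _ _ hx hy =>
    obtain ⟨a, rfl⟩ := hx
    obtain ⟨b, rfl⟩ := hy
    exact ⟨a + b, by rw [Dl_add]; ring⟩
  | smul r x _ hx =>
    obtain ⟨a, rfl⟩ := hx
    exact ⟨C r * a, by rw [Dl_mul, Dl_C, MvPolynomial.smul_eq_C_mul]; ring⟩

variable [Fintype V]

/-- Pull back along a map of vertices. -/
def rho (f : V → V) : MvPolynomial V K →ₐ[K] MvPolynomial V K :=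
  aeval fun w => ∑ v with f v = w, X v

lemma rho_X (f : V → V) (w : V) :
    (rho f (X w) : MvPolynomial V K) = ∑ v with f v = w, X v := by simp [rho]

lemma rho_sumX (f : V → V) (I : Finset V) :
    (rho f (∑ v ∈ I, X v) : MvPolynomial V K) = ∑ v with f v ∈ I, X v := by
  rw [map_sum]
  simp only [rho_X, Finset.sum_filter]
  rw [Finset.sum_comm]
  simp

lemma rho_Dl (q : K) (f : V → V) (a b : V) (p : MvPolynomial V K) :
    rho f (Dl q (f a) (f b) p) = Dl q a b (rho f p) := by
  induction p using MvPolynomial.induction_on with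
  | C r => rw [Dl_C, ← MvPolynomial.algebraMap_eq, AlgHom.commutes, MvPolynomial.algebraMap_eq,
      Dl_C, map_zero]
  | add p r hp hr => simp [Dl_add, hp, hr]
  | mul_X p v hp =>
    have h1 : rho f (Dl q (f a) (f b) (X v : MvPolynomial V K)) = Dl q a b (rho f (X v)) := by
      rw [rho_X, Dl_sumX, Dl_X]
      simp only [map_sub, Finset.mem_filter, Finset.mem_univ, true_and, eq_comm (a := v)]
      congr 1 <;> split_ifs <;> simp
    have h2 : rho f (C q : MvPolynomial V K) = C q := (rho f).commutes q
    rw [Dl_mul, map_add, map_mul, map_mul, map_add, map_mul, hp, h1, h2, map_mul, Dl_mul]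

lemma constantCoeff_rho (f : V → V) (p : MvPolynomial V K) :
    constantCoeff (rho f p) = constantCoeff p := by
  induction p using MvPolynomial.induction_on with
  | C r => rw [← MvPolynomial.algebraMap_eq, AlgHom.commutes]
  | add p r hp hr => simp [hp, hr]
  | mul_X p v hp => rw [map_mul, map_mul, hp, rho_X]; simp

lemma NN_rho (q : K) (f : V → V) (G : List (V × V)) (p : MvPolynomial V K) :
    NN q (G.map (Prod.map f f)) p ↔ NN q G (rho f p) := by
  induction G generalizing p with
  | nil => simp [NN, constantCoeff_rho]
  | cons e G ih => simp only [List.map_cons, NN, ih, Prod.map_fst, Prod.map_snd, rho_Dl]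

lemma map_fall (q : K) (f : V → V) (z : MvPolynomial V K) (k : ℕ) :
    rho f (fall q z k) = fall q (rho f z) k := by
  have h2 : ∀ r : K, rho f (C r : MvPolynomial V K) = C r := fun r => (rho f).commutes r
  simp only [fall, map_prod, map_sub, h2]

lemma rho_gen (q : K) (f : V → V) (G : List (V × V)) (I : Finset V) :
    rho f (gen q (G.map (Prod.map f f)) I) = gen q G (univ.filter fun v => f v ∈ I) := by
  have h2 : ∀ r : K, rho f (C r : MvPolynomial V K) = C r := fun r => (rho f).commutes r
  have h3 : cI I (G.map (Prod.map f f)) = cI (univ.filter fun v => f v ∈ I) G := by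
    simp only [cI, List.countP_map]; congr 1; ext e; simp
  have h4 : cO I (G.map (Prod.map f f)) = cO (univ.filter fun v => f v ∈ I) G := by
    simp only [cO, List.countP_map]; congr 1; ext e; simp
  rw [gen, map_fall, map_add, rho_sumX, h2, h3, h4, gen]

/-- Contraction of `j` to `i`. -/
def ct (i j : V) (v : V) : V := if v = j then i else v

lemma rho_JJ (q : K) (i j : V) (G : List (V × V)) (p : MvPolynomial V K)
    (hp : p ∈ JJ q (G.map (Prod.map (ct i j) (ct i j)))) :
    rho (ct i j) p ∈ JJ q ((i, j) :: G) := by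
  have : JJ q (G.map (Prod.map (ct i j) (ct i j))) ≤
      (JJ q ((i, j) :: G)).comap (rho (ct i j) : MvPolynomial V K →ₐ[K] _) := by
    refine Ideal.span_le.2 ?_
    rintro _ ⟨I, rfl⟩
    change rho (ct i j) (gen q (G.map (Prod.map (ct i j) (ct i j))) I) ∈ JJ q ((i, j) :: G)
    rw [rho_gen]
    set I' := univ.filter fun v => ct i j v ∈ I with hI'
    have h : gen q G I' = gen q ((i, j) :: G) I' := by
      have : i ∈ I' ↔ j ∈ I' := by
        rw [hI', Finset.mem_filter, Finset.mem_filter, show ct i j i = ct i j j by simp [ct]]; simp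
      by_cases hj : j ∈ I'
      · have hi := this.2 hj
        simp [gen, cI, cO, List.countP_cons, hi, hj]
      · have hi : i ∉ I' := fun h => hj (this.1 h)
        simp [gen, cI, cO, List.countP_cons, hi, hj]
    rw [h]; exact gen_mem _ _ _
  exact this hp

lemma Dl_range (q : K) (i j : V) (c : MvPolynomial V K)
    (hc : c ∈ (rho (ct i j) : MvPolynomial V K →ₐ[K] _).range) : Dl q i j c = 0 := by
  obtain ⟨p, rfl⟩ := hc
  change Dl q i j (rho (ct i j) p) = 0
  rw [← rho_Dl]
  have : ct i j i = ct i j j := by simp [ct]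
  rw [this, Dl_self (K := K), map_zero]

lemma X_mem_range (i j v : V) (hi : v ≠ i) (hj : v ≠ j) :
    (X v : MvPolynomial V K) ∈ (rho (ct i j) : MvPolynomial V K →ₐ[K] _).range := by
  refine ⟨X v, ?_⟩
  change rho _ _ = _
  rw [rho_X, show (univ.filter fun w => ct i j w = v) = {v} from ?_, Finset.sum_singleton]
  ext w
  rw [Finset.mem_filter, Finset.mem_singleton]
  simp only [Finset.mem_univ, true_and, ct]
  split_ifs with h
  · subst h; exact ⟨fun h => absurd h.symm hi, fun h => absurd h.symm hj⟩
  · rfl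

lemma XX_mem_range (i j : V) (hij : i ≠ j) :
    (X i + X j : MvPolynomial V K) ∈ (rho (ct i j) : MvPolynomial V K →ₐ[K] _).range := by
  refine ⟨X i, ?_⟩
  change rho _ _ = _
  rw [rho_X, show (univ.filter fun w => ct i j w = i) = {i, j} from ?_, Finset.sum_pair hij]
  ext w
  rw [Finset.mem_filter, Finset.mem_insert, Finset.mem_singleton]
  simp only [Finset.mem_univ, true_and, ct]
  split_ifs with h <;> simp [h]

lemma hS_of (i j : V) (hij : i ≠ j) (z : MvPolynomial V K)
    (hz : z - X i ∈ (rho (ct i j) : MvPolynomial V K →ₐ[K] _).range) (v : V) :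
    ∃ c ∈ (rho (ct i j) : MvPolynomial V K →ₐ[K] _).range, ∃ t : K, X v = c + C t * z := by
  by_cases hi : v = i
  · subst hi
    exact ⟨-(z - X v), neg_mem hz, 1, by simp⟩
  by_cases hj : v = j
  · subst hj
    exact ⟨(X i + X v) + (z - X i), add_mem (XX_mem_range i v hij) hz, -1, by rw [map_neg, map_one]; ring⟩
  · exact ⟨X v, X_mem_range i j v hi hj, 0, by simp⟩

lemma z_mem (i j : V) (hij : i ≠ j) (I : Finset V) (z : MvPolynomial V K)
    (h : (i ∈ I ∧ j ∉ I ∧ ∃ r : K, z = (∑ v ∈ I, X v) + C r) ∨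
       (i ∉ I ∧ j ∈ I ∧ ∃ r : K, z = -(∑ v ∈ I, X v) + C r)) :
    z - X i ∈ (rho (ct i j) : MvPolynomial V K →ₐ[K] _).range := by
  rcases h with ⟨hi, hj, r, rfl⟩ | ⟨hi, hj, r, rfl⟩
  · rw [← Finset.add_sum_erase I _ hi, show ∀ s t u : MvPolynomial V K, s + t + u - s = t + u from
      fun s t u => by ring]
    refine add_mem (sum_mem fun v hv => ?_) (C_mem _ r)
    rw [Finset.mem_erase] at hv
    exact X_mem_range i j v hv.1 fun h => hj (h ▸ hv.2)
  · rw [← Finset.add_sum_erase I _ hj, show ∀ s t u w : MvPolynomial V K,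
      -(s + t) + u - w = -t + u - (w + s) from fun s t u w => by ring]
    refine sub_mem (add_mem (neg_mem (sum_mem fun v hv => ?_)) (C_mem _ r)) (XX_mem_range i j hij)
    rw [Finset.mem_erase] at hv
    exact X_mem_range i j v (fun h => hi (h ▸ hv.2)) hv.1

lemma JJ_lift_aux (q : K) (i j : V) (hij : i ≠ j) (G : List (V × V)) (p : MvPolynomial V K)
    (hp : p ∈ JJ q G) : ∀ m, ∃ r ∈ JJ q ((i, j) :: G), Dl q i j r = m * p := by
  unfold JJ at hp
  induction hp using Submodule.span_induction with
  | mem x hx =>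
    obtain ⟨I, rfl⟩ := hx
    intro m
    rcases gen_cases q i j G I with ⟨h1, h2⟩ | ⟨z, u, w, N, hu, hw, hDu, hz, h1, h2, h3⟩
    · obtain ⟨m', rfl⟩ := Dl_surj q i j _ (X i) (hS_of i j hij (X i) (by simp))
        (Dl_range q i j) (by simp [Dl_X, hij]) m
      refine ⟨gen q ((i, j) :: G) I * m', Ideal.mul_mem_right _ _ (gen_mem _ _ _), ?_⟩
      rw [Dl_mul, h2, h1]; ring
    · obtain ⟨m', hm'⟩ := op_surj q i j _ z (hS_of i j hij z (z_mem i j hij I z h3))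
        (Dl_range q i j) hz N (m * w)
      refine ⟨fall q z (N + 1) * m', Ideal.mul_mem_right _ _ (fall_mem_of q _ I u _ hu h1), ?_⟩
      rw [Dl_mul, Dl_fall _ _ _ _ hz, h2, ← mul_assoc, ← hm', fall_succ]
      simp only [map_mul, map_natCast]
      ring
  | zero => intro m; exact ⟨0, zero_mem _, by rw [mul_zero]; exact Dl_zero ..⟩
  | add x y _ _ hx hy =>
    intro m
    obtain ⟨a, ha, ha'⟩ := hx m
    obtain ⟨b, hb, hb'⟩ := hy m
    exact ⟨a + b, add_mem ha hb, by rw [Dl_add, ha', hb', mul_add]⟩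
  | smul r x _ hx =>
    intro m
    obtain ⟨a, ha, ha'⟩ := hx (m * r)
    exact ⟨a, ha, by rw [ha', smul_eq_mul, mul_assoc]⟩

lemma NN_le_JJ (q : K) (N : ℕ) (G : List (V × V)) (hG : G.length = N) (p : MvPolynomial V K)
    (hp : NN q G p) : p ∈ JJ q G := by
  induction N generalizing G p with
  | zero =>
    rw [List.length_eq_zero_iff] at hG
    subst hG
    have hX : ∀ v, X v ∈ JJ q ([] : List (V × V)) := fun v => by
      have := gen_mem q [] {v}
      simpa [gen, cI, cO, fall] using this
    have h : ∀ r : MvPolynomial V K, r - C (constantCoeff r) ∈ JJ q ([] : List (V × V)) := by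
      intro r
      induction r using MvPolynomial.induction_on with
      | C t => simp
      | add r s hr hs =>
        have := add_mem hr hs
        rw [map_add, map_add]; convert this using 1; ring
      | mul_X r v _ => simpa using Ideal.mul_mem_left _ r (hX v)
    have h' := h p
    have h0 : constantCoeff p = 0 := hp
    rw [h0] at h'
    simpa using h'
  | succ N ih =>
    cases G with
    | nil => simp at hG
    | cons e G =>
      obtain ⟨i, j⟩ := e
      have hG' : G.length = N := by simpa using hG
      by_cases hij : i = j
      · subst hij
        have h1 := ih G hG' p hp.1
        have : JJ q ((i, i) :: G) = JJ q G := by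
          unfold JJ
          congr 2
          ext1 I
          simp [gen, cI, cO, List.countP_cons]
        rw [this]; exact h1
      · have h1 := ih G hG' _ hp.2
        obtain ⟨r, hr, hr'⟩ := JJ_lift_aux q i j hij G _ h1 1
        rw [one_mul] at hr'
        have h2 : Dl q i j (p - r) = 0 := by rw [Dl_sub, hr']; exact sub_self _
        have h3 := ker_Dl q i j _ (X i) (hS_of i j hij (X i) (by simp))
          (Dl_range q i j) (by simp [Dl_X, hij]) _ h2
        obtain ⟨s, hs⟩ := h3
        have hs : rho (ct i j) s = p - r := hs
        have h4 : NN q ((i, j) :: G) (p - r) := NN_sub _ _ _ _ hp (JJ_le_NN _ _ _ hr)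
        have h5 : NN q (G.map (Prod.map (ct i j) (ct i j))) s := by
          rw [NN_rho, hs]; exact h4.1
        have h6 := rho_JJ q i j G s (ih _ (by simpa using hG') _ h5)
        rw [hs] at h6
        have := add_mem h6 hr
        simpa using this

end Helpers

section Phi

open Finset

variable {K : Type*} [Field K] {n : ℕ} {E : Type*} (a b : E → Fin n) (q : K)

/-- edge variable in the quotient -/
def uu (E : Type*) (q : K) (e : E) : PhiAlg K E fun _ => q := Ideal.Quotient.mk _ (X e)

lemma uu_mul (q : K) (e : E) :
    uu E q e * uu E q e = algebraMap K (PhiAlg K E fun _ => q) q * uu E q e := by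
  have h : (X e : MvPolynomial E K) ^ 2 - C q * X e ∈ relIdeal K E fun _ => q :=
    Ideal.subset_span ⟨e, rfl⟩
  have h2 := Ideal.Quotient.eq_zero_iff_mem.2 h
  rw [map_sub, map_pow, map_mul, sub_eq_zero, sq] at h2
  exact h2

/-- the substitution using only the edges in `L` -/
def phiL (L : List E) : MvPolynomial (Fin n) K →ₐ[K] PhiAlg K E fun _ => q :=
  aeval fun v => (L.map fun e => uu E q e *
    ((if v = a e then 1 else 0) - (if v = b e then 1 else 0))).sum

lemma phiL_cons (e : E) (L : List E) (p : MvPolynomial (Fin n) K) :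
    phiL a b q (e :: L) p = phiL a b q L p + uu E q e * phiL a b q L (Dl q (a e) (b e) p) := by
  induction p using MvPolynomial.induction_on with
  | C r => simp [phiL, Dl_C]
  | add p r hp hr => rw [map_add, hp, hr, Dl_add, map_add, map_add]; ring
  | mul_X p v hp =>
    have hX : phiL a b q (e :: L) (X v) = phiL a b q L (X v) +
        uu E q e * phiL a b q L (Dl q (a e) (b e) (X v)) := by
      have : phiL a b q L (Dl q (a e) (b e) (X v)) =
          (if v = a e then 1 else 0) - (if v = b e then 1 else 0) := by
        rw [Dl_X, map_sub]; congr 1 <;> split_ifs <;> simp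
      rw [this]
      simp only [phiL, aeval_X, List.map_cons, List.sum_cons]; ring
    have hq : phiL a b q L (C q) = algebraMap K _ q := (phiL a b q L).commutes q
    rw [map_mul, hp, hX, Dl_mul, map_add, map_mul, map_mul, map_mul, map_add, map_mul, hq]
    linear_combination (phiL a b q L (Dl q (a e) (b e) p) *
      phiL a b q L (Dl q (a e) (b e) (X v))) * uu_mul q e

variable [DecidableEq E]

/-- Separate the variable of the edge `e`. -/
def psi (e : E) : PhiAlg K E (fun _ => q) →ₐ[K]
    QuadraticAlgebra (PhiAlg K E fun _ => q) 0 (algebraMap K _ q) :=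
  Ideal.Quotient.liftₐ _
    (aeval fun e' => if e' = e then ⟨0, 1⟩ else ⟨uu E q e', 0⟩) (by
      intro x hx
      have : relIdeal K E (fun _ => q) ≤ RingHom.ker (aeval (R := K) fun e' =>
          if e' = e then (⟨0, 1⟩ : QuadraticAlgebra (PhiAlg K E fun _ => q) 0 (algebraMap K _ q))
          else ⟨uu E q e', 0⟩) := by
        refine Ideal.span_le.2 ?_
        rintro _ ⟨e', rfl⟩
        have hC : (algebraMap K (QuadraticAlgebra (PhiAlg K E fun _ => q) 0 (algebraMap K _ q)) q)
          = ⟨algebraMap K _ q, 0⟩ := rfl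
        simp only [SetLike.mem_coe, RingHom.mem_ker, map_sub, map_pow, map_mul, aeval_X, aeval_C,
          hC]
        split_ifs
        · ext <;> simp [sq]
        · ext <;> simp [sq, uu_mul]
      exact this hx)

lemma psi_uu (e e' : E) : psi q e (uu E q e') = if e' = e then ⟨0, 1⟩ else ⟨uu E q e', 0⟩ := by
  have : psi q e (uu E q e') = aeval (R := K) (fun e' => if e' = e then
      (⟨0, 1⟩ : QuadraticAlgebra (PhiAlg K E fun _ => q) 0 (algebraMap K _ q))
          else ⟨uu E q e', 0⟩) (X e') := Ideal.Quotient.lift_mk _ _ _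
  rw [this, aeval_X]

lemma psi_phiL (e : E) (L : List E) (he : e ∉ L) (p : MvPolynomial (Fin n) K) :
    psi q e (phiL a b q L p) = ⟨phiL a b q L p, 0⟩ := by
  induction p using MvPolynomial.induction_on with
  | C r =>
    have : phiL a b q L (C r) = algebraMap K _ r := (phiL a b q L).commutes r
    rw [this, AlgHom.commutes]; rfl
  | add p r hp hr => rw [map_add, map_add, hp, hr]; ext <;> simp
  | mul_X p v hp =>
    have hX : psi q e (phiL a b q L (X v)) = ⟨phiL a b q L (X v), 0⟩ := by
      simp only [phiL, aeval_X]
      clear hp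
      induction L with
      | nil => simp; rfl
      | cons f L ih =>
        have hf : f ≠ e := fun h => he (by simp [h])
        simp only [List.map_cons, List.sum_cons, map_add, map_mul, psi_uu, if_neg hf]
        rw [ih (fun h => he (by simp [h]))]
        have h01 : ∀ (P : Prop) [Decidable P], psi q e (if P then 1 else 0) =
            ⟨if P then 1 else 0, 0⟩ := by
          intro P _; split_ifs
          · rw [map_one]; rfl
          · rw [map_zero]; rfl
        rw [map_sub, h01, h01]
        ext <;> simp
    rw [map_mul, map_mul, hp, hX]; ext <;> simp

instance phi_nontrivial : Nontrivial (PhiAlg K E fun _ => q) := by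
  have h : relIdeal K E (fun _ => q) ≤ RingHom.ker (constantCoeff : MvPolynomial E K →+* K) := by
    refine Ideal.span_le.2 ?_
    rintro _ ⟨e', rfl⟩
    simp [RingHom.mem_ker]
  refine Ideal.Quotient.nontrivial_iff.2 fun h' => ?_
  rw [h'] at h
  have := h (show (1 : MvPolynomial E K) ∈ (⊤ : Ideal (MvPolynomial E K)) from trivial)
  simp [RingHom.mem_ker] at this

lemma NN_iff (L : List E) (hL : L.Nodup) (p : MvPolynomial (Fin n) K) :
    NN q (L.map fun e => (a e, b e)) p ↔ phiL a b q L p = 0 := by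
  induction L generalizing p with
  | nil =>
    have : phiL a b q [] p = algebraMap K _ (constantCoeff p) := by
      simp only [phiL, List.map_nil, List.sum_nil]
      exact MvPolynomial.aeval_zero' p
    rw [this]
    simp [NN]
  | cons e L ih =>
    rw [List.nodup_cons] at hL
    simp only [List.map_cons, NN]
    rw [ih hL.2, ih hL.2, phiL_cons]
    constructor
    · rintro ⟨h1, h2⟩; rw [h1, h2]; simp
    · intro h
      have h' := congrArg (psi q e) h
      rw [map_add, map_mul, psi_phiL _ _ _ _ _ hL.1, psi_phiL _ _ _ _ _ hL.1, psi_uu, if_pos rfl,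
        map_zero, QuadraticAlgebra.ext_iff] at h'
      simpa using h'

lemma phiL_univ [Fintype E] :
    phiL a b q (univ : Finset E).toList = MvPolynomial.aeval (XX K a b fun _ => q) := by
  unfold phiL
  congr 1
  ext1 v
  rw [Finset.sum_map_toList, XX]
  simp only [mul_sub, mul_ite, mul_one, mul_zero, Finset.sum_sub_distrib, map_sub, map_sum,
    Finset.sum_filter, uu, eq_comm (a := v), apply_ite (Ideal.Quotient.mk _), map_zero]

lemma countP_univ [Fintype E] (P : E → Prop) [DecidablePred P] :
    (univ : Finset E).toList.countP (fun e => P e) = (univ.filter P).card := by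
  rw [← Multiset.coe_countP, Finset.coe_toList, Multiset.countP_eq_card_filter]
  rfl

lemma prod_Icc_eq (s : MvPolynomial (Fin n) K) (m k : ℕ) :
    ∏ t ∈ Finset.Icc (-(m : ℤ)) (k : ℤ), (s - C (q * (t : K))) =
      fall q (s + C (q * (m : K))) (m + k + 1) := by
  unfold fall
  symm
  refine Finset.prod_bij' (fun t _ => (t : ℤ) - m) (fun t _ => (t + m).toNat) ?_ ?_ ?_ ?_ ?_
  · intro t ht; simp at ht ⊢; omega
  · intro t ht; simp at ht ⊢; omega
  · intro t ht; simp
  · intro t ht; simp at ht ⊢; omega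
  · intro t ht; push_cast; simp only [map_mul, map_sub]; ring

end Phi

/-- For the Hecke deformation, all relations among the `X_i` are generated by
the cut relations `∏_{k=-d⃗_I}^{d⃖_I} (∑_{i ∈ I} x_i - q k)`. -/
theorem hecke_kernel_eq
    {K : Type*} [Field K] [CharZero K] {n : ℕ} {E : Type*} [Fintype E] [DecidableEq E]
    (a b : E → Fin n) (hab : ∀ e, a e < b e) (q : K) :
    RingHom.ker (MvPolynomial.aeval (XX K a b fun _ => q) :
        MvPolynomial (Fin n) K →ₐ[K] PhiAlg K E fun _ => q) =
      Ideal.span {p : MvPolynomial (Fin n) K | ∃ I : Finset (Fin n), I.Nonempty ∧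
        p = ∏ k ∈ Finset.Icc (-((cutIn a b I).card : ℤ)) ((cutOut a b I).card : ℤ),
          ((∑ i ∈ I, X i) - C (q * (k : K)))} := by
  have hgen : ∀ I : Finset (Fin n),
      ∏ k ∈ Finset.Icc (-((cutIn a b I).card : ℤ)) ((cutOut a b I).card : ℤ),
          ((∑ i ∈ I, X i) - C (q * (k : K))) =
        gen q ((Finset.univ : Finset E).toList.map fun e => (a e, b e)) I := by
    intro I
    rw [prod_Icc_eq, gen]
    have h1 : cI I ((Finset.univ : Finset E).toList.map fun e => (a e, b e)) =
        (cutIn a b I).card := by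
      rw [cI, List.countP_map, cutIn, ← countP_univ]; rfl
    have h2 : cO I ((Finset.univ : Finset E).toList.map fun e => (a e, b e)) =
        (cutOut a b I).card := by
      rw [cO, List.countP_map, cutOut, ← countP_univ]; rfl
    rw [h1, h2]
  ext p
  rw [RingHom.mem_ker, ← phiL_univ, ← NN_iff a b q _ (Finset.nodup_toList _)]
  have hJ : Ideal.span {p : MvPolynomial (Fin n) K | ∃ I : Finset (Fin n), I.Nonempty ∧
        p = ∏ k ∈ Finset.Icc (-((cutIn a b I).card : ℤ)) ((cutOut a b I).card : ℤ),
          ((∑ i ∈ I, X i) - C (q * (k : K)))} =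
      JJ q ((Finset.univ : Finset E).toList.map fun e => (a e, b e)) := by
    apply le_antisymm
    · refine Ideal.span_le.2 ?_
      rintro _ ⟨I, -, rfl⟩
      rw [hgen]; exact gen_mem _ _ _
    · refine Ideal.span_le.2 ?_
      rintro _ ⟨I, rfl⟩
      rcases I.eq_empty_or_nonempty with rfl | hI
      · rw [← hgen]; simp [cutIn, cutOut]
      · exact Ideal.subset_span ⟨I, hI, (hgen I).symm⟩
  rw [hJ]
  exact ⟨NN_le_JJ q _ _ rfl p, JJ_le_NN q _ p⟩

end
end

section
/- Let G be a loopless weighted graph, i.e., q_e ≠ 0 for every edge e. Then the K-algebra homomorphism from Φ_{G,Q} to the algebra of K-valued functions on the set of all subsets of E (with pointwise addition and multiplication) determined on generators by sending u_e to the function E' ↦ (q_e if e ∈ E', else 0) is an isomorphism of K-algebras. -/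
open MvPolynomial

set_option synthInstance.maxHeartbeats 1000000
set_option maxHeartbeats 1000000

noncomputable section

/-- The function on subsets of edges associated to the generator `u_e`. -/
def edgeFun {K : Type*} [Field K] {E : Type*} [DecidableEq E] (q : E → K) (e : E) :
    Finset E → K := fun E' => if e ∈ E' then q e else 0

/-- The idempotent of `Φ_{G,Q}` attached to a subset `S` of edges. -/
def idem {K : Type*} [Field K] {E : Type*} [Fintype E] [DecidableEq E] (q : E → K)
    (S : Finset E) : MvPolynomial E K :=
  (∏ e ∈ S, C (q e)⁻¹ * X e) * ∏ e ∈ Finset.univ \ S, (1 - C (q e)⁻¹ * X e)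

lemma idem_sum {K : Type*} [Field K] {E : Type*} [Fintype E] [DecidableEq E] (q : E → K) :
    ∑ S : Finset E, idem q S = 1 := by
  have h := Finset.prod_add (fun e : E => (C (q e)⁻¹ * X e : MvPolynomial E K))
    (fun e => 1 - C (q e)⁻¹ * X e) Finset.univ
  simp only [add_sub_cancel, Finset.prod_const_one, Finset.powerset_univ] at h
  exact h.symm

lemma X_mul_idem {K : Type*} [Field K] {E : Type*} [Fintype E] [DecidableEq E] (q : E → K)
    (hq : ∀ e, q e ≠ 0) (S : Finset E) (e : E) :
    X e * idem q S - C (edgeFun q e S) * idem q S ∈ relIdeal K E q := by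
  have hr : (X e) ^ 2 - C (q e) * X e ∈ relIdeal K E q :=
    Ideal.subset_span ⟨e, rfl⟩
  have hc : (C (q e) * C (q e)⁻¹ : MvPolynomial E K) = 1 := by
    rw [← C_mul, mul_inv_cancel₀ (hq e), C_1]
  unfold idem edgeFun
  by_cases he : e ∈ S
  · rw [← Finset.mul_prod_erase S _ he, if_pos he]
    generalize (∏ x ∈ S.erase e, C (q x)⁻¹ * X x : MvPolynomial E K) = A
    generalize (∏ x ∈ Finset.univ \ S, (1 - C (q x)⁻¹ * X x) : MvPolynomial E K) = B
    convert Ideal.mul_mem_left _ (C (q e)⁻¹ * A * B) hr using 1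
    ring
  · have he' : e ∈ Finset.univ \ S := by simp [he]
    rw [← Finset.mul_prod_erase _ _ he', if_neg he]
    generalize (∏ x ∈ (Finset.univ \ S).erase e, (1 - C (q x)⁻¹ * X x) : MvPolynomial E K) = A
    generalize (∏ x ∈ S, C (q x)⁻¹ * X x : MvPolynomial E K) = B
    convert Ideal.mul_mem_left _ (-C (q e)⁻¹ * A * B) hr using 1
    rw [C_0]
    linear_combination (-X e * A * B) * hc

lemma mul_idem {K : Type*} [Field K] {E : Type*} [Fintype E] [DecidableEq E] (q : E → K)
    (hq : ∀ e, q e ≠ 0) (S : Finset E) (P : MvPolynomial E K) :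
    P * idem q S - C (aeval (edgeFun q) P S) * idem q S ∈ relIdeal K E q := by
  induction P using MvPolynomial.induction_on with
  | C a => simp [MvPolynomial.algebraMap_eq]
  | add P Q hP hQ =>
    convert Ideal.add_mem _ hP hQ using 1
    simp only [map_add, Pi.add_apply]
    ring
  | mul_X P e hP =>
    convert Ideal.add_mem _ (Ideal.mul_mem_left _ (X e) hP)
      (Ideal.mul_mem_left _ (C (aeval (edgeFun q) P S)) (X_mul_idem q hq S e)) using 1
    simp only [map_mul, Pi.mul_apply, aeval_X]
    ring

lemma aeval_idem {K : Type*} [Field K] {E : Type*} [Fintype E] [DecidableEq E] (q : E → K)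
    (hq : ∀ e, q e ≠ 0) (S : Finset E) :
    aeval (edgeFun q) (idem q S) = Pi.single S (1 : K) := by
  have hC : ∀ a : K, aeval (edgeFun q) (C a : MvPolynomial E K) = fun _ => a := by
    intro a; ext; simp
  funext T
  simp only [idem, map_mul, map_prod, map_sub, map_one, aeval_X, hC, Pi.mul_apply,
    Finset.prod_apply, Pi.sub_apply, Pi.one_apply, edgeFun]
  by_cases h : T = S
  · subst h
    rw [Pi.single_eq_same, Finset.prod_eq_one, Finset.prod_eq_one, one_mul]
    · intro e he
      simp at he
      simp [he]
    · intro e he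
      simp [he, hq e]
  · rw [Pi.single_eq_of_ne h]
    by_cases hs : S ⊆ T
    · obtain ⟨e, heT, heS⟩ := Finset.not_subset.1 (fun h' => h (Finset.Subset.antisymm h' hs))
      rw [Finset.prod_eq_zero (i := e) (s := Finset.univ \ S), mul_zero]
      · simp [heS]
      · simp [heT, hq e]
    · obtain ⟨e, heS, heT⟩ := Finset.not_subset.1 hs
      rw [Finset.prod_eq_zero heS, zero_mul]
      simp [heT]

/-- For a weighted graph (all `q_e ≠ 0`), the algebra homomorphism from
`Φ_{G,Q}` to functions on subsets of edges determined by `u_e ↦ (E' ↦ q_e if e ∈ E' else 0)`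
is an isomorphism of `K`-algebras. -/
theorem phi_equiv_functions
    {K : Type*} [Field K] [CharZero K] {E : Type*} [Fintype E] [DecidableEq E]
    (q : E → K) (hq : ∀ e, q e ≠ 0) :
    ∃ T : PhiAlg K E q ≃ₐ[K] (Finset E → K),
      ∀ e : E, T (Ideal.Quotient.mk (relIdeal K E q) (X e)) = edgeFun q e := by
  have hle : ∀ P ∈ relIdeal K E q, aeval (edgeFun q) P = 0 := by
    intro P hP
    have : relIdeal K E q ≤ RingHom.ker (aeval (R := K) (edgeFun q)) := by
      unfold relIdeal
      rw [Ideal.span_le]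
      rintro _ ⟨e, rfl⟩
      rw [SetLike.mem_coe, RingHom.mem_ker]
      funext S
      by_cases h : e ∈ S <;> simp [edgeFun, h, pow_two]
    exact this hP
  let F : PhiAlg K E q →ₐ[K] (Finset E → K) :=
    Ideal.Quotient.liftₐ (relIdeal K E q) (aeval (edgeFun q)) hle
  have hF : ∀ P, F (Ideal.Quotient.mk (relIdeal K E q) P) = aeval (edgeFun q) P :=
    fun P => rfl
  have hbij : Function.Bijective F := by
    constructor
    · rw [injective_iff_map_eq_zero]
      intro x hx
      obtain ⟨P, rfl⟩ := Ideal.Quotient.mk_surjective x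
      rw [hF] at hx
      rw [Ideal.Quotient.eq_zero_iff_mem]
      rw [← mul_one P, ← idem_sum q, Finset.mul_sum]
      refine Ideal.sum_mem _ fun S _ => ?_
      have := mul_idem q hq S P
      rw [hx] at this
      simpa using this
    · intro f
      refine ⟨Ideal.Quotient.mk (relIdeal K E q) (∑ S, f S • idem q S), ?_⟩
      rw [hF, map_sum]
      simp only [map_smul, aeval_idem q hq]
      funext T
      simp [Finset.sum_apply, Pi.single_apply]
  refine ⟨AlgEquiv.ofBijective F hbij, fun e => ?_⟩
  rw [AlgEquiv.ofBijective_apply, hF, aeval_X]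

end
end
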